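/- arXiv:2410.06156 — 3 statements merged into one kernel-verified Lean document; each statement's English description precedes it below -/
import Mathlib

section
/- Let s ≥ 1 and k ≥ 2 be integers and R a real number with R > 2^13 · s · ⌈log₂ k⌉. Let G_1, …, G_s be nonempty finite families of finite sets such that each G_i is uniform (all members of G_i have the same size, which is at most k) and each G_i is R-spread. Then there exist pairwise disjoint sets F_1 ∈ G_1, …, F_s ∈ G_s. -/
open Finset
open scoped Classical

variable {γ : Type*}

/-- `F(B) = {F \ B : F ∈ F, B ⊆ F}`. -/
def famRestrict [DecidableEq γ] (F : Finset (Finset γ)) (B : Finset γ) : Finset (Finset γ) :=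
  (F.filter fun A => B ⊆ A).image fun A => A \ B

/-- `F[ℬ] = {F ∈ F : ∃ B ∈ ℬ, B ⊆ F}`. -/
def famAbove [DecidableEq γ] (F ℬ : Finset (Finset γ)) : Finset (Finset γ) :=
  F.filter fun A => ∃ B ∈ ℬ, B ⊆ A

/-- The shadow `∂_h F`. -/
def famShadow [DecidableEq γ] (F : Finset (Finset γ)) (h : ℕ) : Finset (Finset γ) :=
  F.biUnion fun A => Finset.powersetCard h A

/-- The shadow `∂_{≤h} F`. -/
def famShadowLe [DecidableEq γ] (F : Finset (Finset γ)) (h : ℕ) : Finset (Finset γ) :=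
  (Finset.range (h + 1)).biUnion fun j => famShadow F j

/-- `P` is a sunflower with `s` petals and core `K`: `P` consists of `s` sets, `K` is
the intersection of all members of `P`, and any two distinct members intersect in `K`. -/
def IsSunflower [DecidableEq γ] (P : Finset (Finset γ)) (s : ℕ) (K : Finset γ) : Prop :=
  P.card = s ∧ ∃ hP : P.Nonempty, K = P.inf' hP id ∧
    ∀ A ∈ P, ∀ B ∈ P, A ≠ B → A ∩ B = K

/-- `F` contains no sunflower with `s` petals (with arbitrary core). -/
def SunflowerFree [DecidableEq γ] (F : Finset (Finset γ)) (s : ℕ) : Prop :=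
  ∀ P ⊆ F, ∀ K : Finset γ, ¬ IsSunflower P s K

/-- `φ(s,t)`: the maximal size of a family of `t`-element sets with no sunflower
with `s` petals. -/
noncomputable def phi (s t : ℕ) : ℕ :=
  sSup {m : ℕ | ∃ F : Finset (Finset ℕ),
    (∀ A ∈ F, A.card = t) ∧ SunflowerFree F s ∧ F.card = m}

/-- `G` is `R`-spread: `|G(X)| ≤ R^{-|X|} |G|` for every `X`. -/
def IsSpread [DecidableEq γ] (R : ℝ) (G : Finset (Finset γ)) : Prop :=
  ∀ X : Finset γ, ((famRestrict G X).card : ℝ) ≤ R ^ (-(X.card : ℤ)) * G.card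

/-- `F` is `k`-uniform. -/
def IsUniform (F : Finset (Finset γ)) (k : ℕ) : Prop := ∀ A ∈ F, A.card = k

/-- `𝒜` is `(r,t)`-spread: `𝒜(T)` is `r`-spread for every `T ∈ ∂_{≤t} 𝒜`. -/
def IsRTSpread [DecidableEq γ] (𝒜 : Finset (Finset γ)) (r : ℝ) (t : ℕ) : Prop :=
  ∀ T ∈ famShadowLe 𝒜 t, IsSpread r (famRestrict 𝒜 T)

/-- `F` is `τ`-homogeneous with respect to `𝒜`:
`|F(X)| ⬝ |𝒜| ≤ τ^{|X|} ⬝ |F| ⬝ |𝒜(X)|` for every `X`. -/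
def IsHomog [DecidableEq γ] (τ : ℝ) (F 𝒜 : Finset (Finset γ)) : Prop :=
  ∀ X : Finset γ,
    ((famRestrict F X).card : ℝ) * 𝒜.card ≤ τ ^ X.card * F.card * (famRestrict 𝒜 X).card

section Spread

variable {α : Type*} [DecidableEq α]

/-- The expectation of `f W` for a random subset `W` of `X` that contains each element of `X`
independently with probability `q`. -/
noncomputable def bernoulliExp (q : ℝ) (X : Finset α) (f : Finset α → ℝ) : ℝ :=
  ∑ W ∈ X.powerset, q ^ W.card * (1 - q) ^ (X \ W).card * f W

lemma bernoulliExp_empty (q : ℝ) (f : Finset α → ℝ) : bernoulliExp q ∅ f = f ∅ := by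
  simp [bernoulliExp]

lemma bernoulliExp_insert (q : ℝ) {X : Finset α} {x : α} (hx : x ∉ X) (f : Finset α → ℝ) :
    bernoulliExp q (insert x X) f =
      (1 - q) * bernoulliExp q X f + q * bernoulliExp q X (fun W => f (insert x W)) := by
  unfold bernoulliExp
  rw [Finset.sum_powerset_insert hx, Finset.mul_sum, Finset.mul_sum]
  congr 1
  · refine Finset.sum_congr rfl fun W hW => ?_
    have hxW : x ∉ W := fun h => hx (Finset.mem_powerset.1 hW h)
    rw [Finset.insert_sdiff_of_notMem _ hxW, Finset.card_insert_of_notMem (by simp [hx])]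
    ring
  · refine Finset.sum_congr rfl fun W hW => ?_
    have hxW : x ∉ W := fun h => hx (Finset.mem_powerset.1 hW h)
    have h : insert x X \ insert x W = X \ W := by
      ext a
      simp only [Finset.mem_sdiff, Finset.mem_insert]
      grind
    rw [h, Finset.card_insert_of_notMem hxW]
    ring

lemma bernoulliExp_mono {q : ℝ} (h0 : 0 ≤ q) (h1 : q ≤ 1) {X : Finset α} {f g : Finset α → ℝ}
    (h : ∀ W ⊆ X, f W ≤ g W) : bernoulliExp q X f ≤ bernoulliExp q X g := by
  refine Finset.sum_le_sum fun W hW => ?_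
  have : 0 ≤ 1 - q := by linarith
  exact mul_le_mul_of_nonneg_left (h W (Finset.mem_powerset.1 hW)) (by positivity)

lemma bernoulliExp_const (q : ℝ) (X : Finset α) (a : ℝ) : bernoulliExp q X (fun _ => a) = a := by
  induction X using Finset.induction_on with
  | empty => rw [bernoulliExp_empty]
  | insert x X hx ih => rw [bernoulliExp_insert q hx, ih]; ring

lemma bernoulliExp_affine (q : ℝ) (X : Finset α) (a b : ℝ) (f : Finset α → ℝ) :
    bernoulliExp q X (fun W => a + b * f W) = a + b * bernoulliExp q X f := by
  induction X using Finset.induction_on generalizing f with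
  | empty => simp only [bernoulliExp_empty]
  | insert x X hx ih =>
    rw [bernoulliExp_insert q hx, bernoulliExp_insert q hx, ih, ih fun W => f (insert x W)]
    ring

lemma bernoulliExp_add_le {q q' : ℝ} (h0 : 0 ≤ q) (h0' : 0 ≤ q') (h1 : q + q' ≤ 1)
    (X : Finset α) {f : Finset α → ℝ} (hf : Antitone f) :
    bernoulliExp (q + q') X f ≤
      bernoulliExp q X fun W => bernoulliExp q' X fun W' => f (W ∪ W') := by
  induction X using Finset.induction_on generalizing f with
  | empty => simp [bernoulliExp_empty]
  | insert x X hx ih =>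
    have hfx : Antitone fun W => f (insert x W) :=
      fun A B hAB => hf (Finset.insert_subset_insert x hAB)
    have e0 := ih hf
    have e1 := ih hfx
    have e2 : (bernoulliExp q X fun W => bernoulliExp q' X fun W' => f (insert x (W ∪ W'))) ≤
        bernoulliExp q X fun W => bernoulliExp q' X fun W' => f (W ∪ W') :=
      bernoulliExp_mono h0 (by linarith) fun W _ =>
        bernoulliExp_mono h0' (by linarith) fun W' _ => hf (Finset.subset_insert _ _)
    have split : ∀ (a b : ℝ) (u v : Finset α → ℝ), bernoulliExp q X (fun W => a * u W + b * v W) =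
        a * bernoulliExp q X u + b * bernoulliExp q X v := by
      intro a b u v
      simp only [bernoulliExp, Finset.mul_sum, ← Finset.sum_add_distrib]
      exact Finset.sum_congr rfl fun W _ => by ring
    simp only [bernoulliExp_insert _ hx, Finset.insert_union, Finset.union_insert,
      Finset.insert_idem, split]
    have : 0 ≤ q * q' := mul_nonneg h0 h0'
    have hc : 0 ≤ 1 - (q + q') := by linarith
    have hd : 0 ≤ q + q' := by linarith
    nlinarith [mul_le_mul_of_nonneg_left e0 hc, mul_le_mul_of_nonneg_left e1 hd,
      mul_le_mul_of_nonneg_left e2 this]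

/-- Every `U i` has a smallest fragment `U i' \ W` outside `W` among those contained in `U i`. -/
lemma exists_min_fragment {ι : Type*} (I : Finset ι) (U : ι → Finset α) (W : Finset α) (i : ι) :
    ∃ T : Finset α, i ∈ I → T ⊆ U i ∧ Disjoint W T ∧ (∃ j ∈ I, U j ⊆ W ∪ T) ∧
      ∀ j ∈ I, U j ⊆ W ∪ U i → T.card ≤ (U j \ W).card := by
  by_cases hi : i ∈ I
  · obtain ⟨j, hj, hmin⟩ := Finset.exists_min_image (I.filter fun j => U j ⊆ W ∪ U i)
      (fun j => (U j \ W).card) ⟨i, by simp [hi]⟩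
    rw [Finset.mem_filter] at hj
    refine ⟨U j \ W, fun _ => ⟨?_, Finset.disjoint_sdiff, ⟨j, hj.1, ?_⟩, fun l hl hs =>
      hmin l (Finset.mem_filter.2 ⟨hl, hs⟩)⟩⟩
    · intro a ha
      rw [Finset.mem_sdiff] at ha
      have := hj.2 ha.1
      grind
    · intro a ha
      grind
  · exact ⟨∅, fun h => absurd h hi⟩

/-- For a spread family of small sets, large minimal fragments are rare. -/
lemma bernoulliExp_card_large_fragment_le {ι : Type*} {q R N : ℝ} (hq : 0 < q) (hq1 : q ≤ 1)
    (hR : 0 < R) (hqR : 1 ≤ q * R) (hN : 0 ≤ N) {X : Finset α} {I : Finset ι} {U : ι → Finset α}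
    {h : ℕ} (hUX : ∀ i ∈ I, U i ⊆ X) (hU : ∀ i ∈ I, (U i).card ≤ 2 * h)
    (hspread : ∀ T : Finset α, ((I.filter fun i => T ⊆ U i).card : ℝ) ≤ R⁻¹ ^ T.card * N)
    {T : Finset α → ι → Finset α} (hTU : ∀ W, ∀ i ∈ I, T W i ⊆ U i)
    (hTW : ∀ W, ∀ i ∈ I, Disjoint W (T W i)) (hTex : ∀ W, ∀ i ∈ I, ∃ j ∈ I, U j ⊆ W ∪ T W i)
    (hTmin : ∀ W, ∀ i ∈ I, ∀ j ∈ I, U j ⊆ W ∪ U i → (T W i).card ≤ (U j \ W).card) :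
    bernoulliExp q X (fun W => ((I.filter fun i => h ≤ (T W i).card).card : ℝ)) ≤
      (4 / (q * R)) ^ h * N := by
  have hV : ∀ Z : Finset α, ∃ V : Finset α, V.card ≤ 2 * h ∧
      ((∃ j ∈ I, U j ⊆ Z) → V ⊆ Z ∧ ∃ j ∈ I, U j = V) := by
    intro Z
    by_cases hZ : ∃ j ∈ I, U j ⊆ Z
    · obtain ⟨j, hj, hjZ⟩ := hZ
      exact ⟨U j, hU j hj, fun _ => ⟨hjZ, j, hj, rfl⟩⟩
    · exact ⟨∅, by simp, fun h => absurd h hZ⟩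
  choose V hVcard hVsub using hV
  have hq' : 0 ≤ 1 - q := by linarith
  have hfrag : ∀ W, ∀ i ∈ I, T W i ⊆ V (W ∪ T W i) := by
    intro W i hi
    obtain ⟨hsub, j, hj, hjV⟩ := hVsub (W ∪ T W i) (hTex W i hi)
    have h1 := hTmin W i hi j hj (by
      rw [hjV]
      exact hsub.trans (Finset.union_subset_union_right (hTU W i hi)))
    rw [hjV] at h1
    have h2 : V (W ∪ T W i) \ W ⊆ T W i := by
      intro a ha
      rw [Finset.mem_sdiff] at ha
      have := hsub ha.1
      grind
    exact (Finset.eq_of_subset_of_card_le h2 h1).symm.subset.trans Finset.sdiff_subset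
  let w : Finset α → ℝ := fun Z => q ^ Z.card * (1 - q) ^ (X \ Z).card
  have hw : ∀ Z, 0 ≤ w Z := fun Z => by positivity
  have hcount : ∀ Z : Finset α,
      ∑ S ∈ (V Z).powerset.filter (fun S => h ≤ S.card),
        ∑ _i ∈ I.filter (fun i => S ⊆ U i), q⁻¹ ^ S.card ≤ (4 / (q * R)) ^ h * N := by
    intro Z
    have hterm : ∀ S ∈ (V Z).powerset.filter (fun S => h ≤ S.card),
        ∑ _i ∈ I.filter (fun i => S ⊆ U i), q⁻¹ ^ S.card ≤ (q * R)⁻¹ ^ h * N := by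
      intro S hS
      rw [Finset.sum_const, nsmul_eq_mul]
      calc ((I.filter fun i => S ⊆ U i).card : ℝ) * q⁻¹ ^ S.card
          ≤ (R⁻¹ ^ S.card * N) * q⁻¹ ^ S.card :=
            mul_le_mul_of_nonneg_right (hspread S) (by positivity)
        _ = (q * R)⁻¹ ^ S.card * N := by rw [mul_inv, mul_pow]; ring
        _ ≤ (q * R)⁻¹ ^ h * N := by
            refine mul_le_mul_of_nonneg_right ?_ hN
            exact pow_le_pow_of_le_one (by positivity) (inv_le_one_of_one_le₀ hqR)
              (Finset.mem_filter.1 hS).2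
    have hcard : (((V Z).powerset.filter (fun S => h ≤ S.card)).card : ℝ) ≤ 4 ^ h := by
      have h1 : ((V Z).powerset.filter (fun S => h ≤ S.card)).card ≤ 2 ^ (2 * h) :=
        (Finset.card_filter_le _ _).trans (by
          rw [Finset.card_powerset]
          exact Nat.pow_le_pow_right (by norm_num) (hVcard Z))
      rw [pow_mul] at h1
      exact_mod_cast h1
    calc _ ≤ ∑ _S ∈ (V Z).powerset.filter (fun S => h ≤ S.card), (q * R)⁻¹ ^ h * N :=
          Finset.sum_le_sum hterm
      _ ≤ 4 ^ h * ((q * R)⁻¹ ^ h * N) := by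
          rw [Finset.sum_const, nsmul_eq_mul]
          exact mul_le_mul_of_nonneg_right hcard (by positivity)
      _ = _ := by rw [div_eq_mul_inv, mul_pow]; ring
  let P : Finset ((_ : Finset α) × ι) :=
    X.powerset.sigma fun W => I.filter fun i => h ≤ (T W i).card
  let Q : Finset ((_ : Finset α) × (_ : Finset α) × ι) :=
    X.powerset.sigma fun Z => ((V Z).powerset.filter (fun S => h ≤ S.card)).sigma
      fun S => I.filter fun i => S ⊆ U i
  let φ : ((_ : Finset α) × ι) → ((_ : Finset α) × (_ : Finset α) × ι) :=
    fun a => ⟨a.1 ∪ T a.1 a.2, T a.1 a.2, a.2⟩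
  have hP : ∀ a ∈ P, a.1 ⊆ X ∧ a.2 ∈ I ∧ h ≤ (T a.1 a.2).card := by
    intro a ha
    simpa [P] using ha
  have hinj : Set.InjOn φ P := by
    rintro ⟨W, i⟩ ha ⟨W', i'⟩ hb hab
    have h1 := hP _ ha
    have h2 := hP _ hb
    simp only [φ, Sigma.mk.injEq, heq_eq_eq] at hab
    obtain ⟨hZ, hT, rfl⟩ := hab
    have d1 := hTW W i h1.2.1
    have d2 := hTW W' i h2.2.1
    have : W = W' := by
      rw [← Finset.union_sdiff_cancel_right d1, ← Finset.union_sdiff_cancel_right d2, hZ, hT]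
    rw [this]
  have himg : P.image φ ⊆ Q := by
    intro b hb
    obtain ⟨a, ha, rfl⟩ := Finset.mem_image.1 hb
    obtain ⟨h1, h2, h3⟩ := hP a ha
    simp only [Q, φ, Finset.mem_sigma, Finset.mem_powerset, Finset.mem_filter]
    exact ⟨Finset.union_subset h1 ((hTU _ _ h2).trans (hUX _ h2)), ⟨hfrag _ _ h2, h3⟩, h2,
      hTU _ _ h2⟩
  have hweight : ∀ a ∈ P, w a.1 ≤ w (φ a).1 * q⁻¹ ^ (φ a).2.1.card := by
    intro a ha
    obtain ⟨h1, h2, h3⟩ := hP a ha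
    have hd := hTW a.1 a.2 h2
    have hTX : T a.1 a.2 ⊆ X := (hTU _ _ h2).trans (hUX _ h2)
    simp only [w, φ]
    have e1 : (a.1 ∪ T a.1 a.2).card = a.1.card + (T a.1 a.2).card :=
      Finset.card_union_of_disjoint hd
    have e2 : (X \ (a.1 ∪ T a.1 a.2)).card ≤ (X \ a.1).card :=
      Finset.card_le_card (Finset.sdiff_subset_sdiff subset_rfl Finset.subset_union_left)
    have e3 : (1 - q) ^ (X \ a.1).card ≤ (1 - q) ^ (X \ (a.1 ∪ T a.1 a.2)).card :=
      pow_le_pow_of_le_one hq' (by linarith) e2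
    rw [e1, pow_add, inv_pow]
    have hqT : q ^ (T a.1 a.2).card ≠ 0 := by positivity
    calc _ ≤ q ^ a.1.card * (1 - q) ^ (X \ (a.1 ∪ T a.1 a.2)).card :=
          mul_le_mul_of_nonneg_left e3 (by positivity)
      _ = _ := by field_simp
  calc bernoulliExp q X (fun W => ((I.filter fun i => h ≤ (T W i).card).card : ℝ))
      = ∑ a ∈ P, w a.1 := by
        simp only [bernoulliExp, P, Finset.sum_sigma, Finset.sum_const, nsmul_eq_mul, w]
        exact Finset.sum_congr rfl fun W _ => by ring
    _ ≤ ∑ a ∈ P, w (φ a).1 * q⁻¹ ^ (φ a).2.1.card := Finset.sum_le_sum hweight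
    _ = ∑ b ∈ P.image φ, w b.1 * q⁻¹ ^ b.2.1.card :=
        (Finset.sum_image (f := fun b => w b.1 * q⁻¹ ^ b.2.1.card) hinj).symm
    _ ≤ ∑ b ∈ Q, w b.1 * q⁻¹ ^ b.2.1.card :=
        Finset.sum_le_sum_of_subset_of_nonneg himg fun b _ _ =>
          mul_nonneg (hw _) (by positivity)
    _ = bernoulliExp q X fun Z => ∑ S ∈ (V Z).powerset.filter (fun S => h ≤ S.card),
          ∑ _i ∈ I.filter (fun i => S ⊆ U i), q⁻¹ ^ S.card := by
        simp only [bernoulliExp, Q, Finset.sum_sigma, Finset.mul_sum, w]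
    _ ≤ bernoulliExp q X fun _ => (4 / (q * R)) ^ h * N :=
        bernoulliExp_mono hq.le hq1 fun Z _ => hcount Z
    _ = _ := bernoulliExp_const _ _ _

lemma antitone_avoid {ι : Type*} (I : Finset ι) (U : ι → Finset α) {a b : ℝ} (hab : a ≤ b) :
    Antitone fun W : Finset α => if ∃ i ∈ I, U i ⊆ W then a else b := by
  intro A B hAB
  dsimp only
  by_cases hA : ∃ i ∈ I, U i ⊆ A
  · obtain ⟨i, hi, hiA⟩ := hA
    rw [if_pos ⟨i, hi, hiA.trans hAB⟩, if_pos ⟨i, hi, hiA⟩]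
  · rw [if_neg hA]
    split_ifs
    · exact hab
    · exact le_rfl

/-- A random set contains a member of a spread family with high probability. -/
lemma bernoulliExp_avoid_le {ι : Type*} {q R N : ℝ} (hq : 0 < q) (hR : 0 < R)
    (hqR : 2 ^ 11 ≤ q * R) (hN : 0 < N) {X : Finset α} (L : ℕ) (hL : L * q ≤ 1)
    {I : Finset ι} {U : ι → Finset α}
    (hUX : ∀ i ∈ I, U i ⊆ X) (hU : ∀ i ∈ I, (U i).card < 2 ^ L)
    (hspread : ∀ T : Finset α, ((I.filter fun i => T ⊆ U i).card : ℝ) ≤ R⁻¹ ^ T.card * N) :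
    bernoulliExp (L * q) X (fun W => if ∃ i ∈ I, U i ⊆ W then 0 else 1) ≤
      1 - I.card / N + (1 - (1 / 2) ^ L) / 32 := by
  induction L generalizing I U with
  | zero =>
    have hcard : (I.card : ℝ) / N ≤ 1 := by
      rw [div_le_one hN]
      simpa using hspread ∅
    rcases I.eq_empty_or_nonempty with rfl | ⟨i, hi⟩
    · simp [bernoulliExp_const]
    · have hUi : U i = ∅ := by
        have := hU i hi
        simpa using this
      have : (fun W : Finset α => if ∃ i ∈ I, U i ⊆ W then (0 : ℝ) else 1) = fun _ => 0 := by
        funext W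
        exact if_pos ⟨i, hi, by simp [hUi]⟩
      rw [this, bernoulliExp_const]
      norm_num
      exact hcard
  | succ L ih =>
    push_cast at hL
    have hLq : 0 ≤ (L : ℝ) * q := by positivity
    have hq1 : q ≤ 1 := by linarith
    choose T hT using fun W i => exists_min_fragment I U W i
    let J : Finset α → Finset ι := fun W => I.filter fun i => (T W i).card < 2 ^ L
    have hstep : ∀ W ⊆ X, bernoulliExp (L * q) X
        (fun W' => if ∃ i ∈ I, U i ⊆ W ∪ W' then 0 else 1) ≤
        (1 - I.card / N + (1 - (1 / 2) ^ L) / 32) +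
          1 / N * ((I.filter fun i => 2 ^ L ≤ (T W i).card).card : ℝ) := by
      intro W _
      have hsplit : (J W).card + (I.filter fun i => 2 ^ L ≤ (T W i).card).card = I.card := by
        have := Finset.card_filter_add_card_filter_not (s := I) fun i => (T W i).card < 2 ^ L
        simpa only [J, not_lt] using this
      have hsplit' : ((J W).card : ℝ) + ((I.filter fun i => 2 ^ L ≤ (T W i).card).card : ℝ) =
          I.card := by exact_mod_cast hsplit
      have hJ : ∀ i ∈ J W, i ∈ I ∧ (T W i).card < 2 ^ L := fun i hi => Finset.mem_filter.1 hi
      have h1 := ih (by linarith) (I := J W) (U := T W)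
        (fun i hi => ((hT W i (hJ i hi).1).1).trans (hUX i (hJ i hi).1))
        (fun i hi => (hJ i hi).2)
        (fun S => le_trans (by
          refine Nat.cast_le.2 (Finset.card_le_card fun i hi => ?_)
          obtain ⟨hi1, hi2⟩ := Finset.mem_filter.1 hi
          exact Finset.mem_filter.2 ⟨(hJ i hi1).1, hi2.trans (hT W i (hJ i hi1).1).1⟩) (hspread S))
      have h2 : bernoulliExp (L * q) X (fun W' => if ∃ i ∈ I, U i ⊆ W ∪ W' then 0 else 1) ≤
          bernoulliExp (L * q) X (fun W' => if ∃ i ∈ J W, T W i ⊆ W' then 0 else 1) := by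
        refine bernoulliExp_mono hLq (by linarith) fun W' _ => ?_
        by_cases hW' : ∃ i ∈ J W, T W i ⊆ W'
        · obtain ⟨i, hi, hiW⟩ := hW'
          obtain ⟨j, hj, hjW⟩ := (hT W i (hJ i hi).1).2.2.1
          rw [if_pos ⟨j, hj, hjW.trans (Finset.union_subset_union_right hiW)⟩]
          split_ifs <;> norm_num
        · rw [if_neg hW']
          split_ifs <;> norm_num
      refine h2.trans (h1.trans (le_of_eq ?_))
      rw [← hsplit']
      field_simp
      ring
    have hlarge := bernoulliExp_card_large_fragment_le hq hq1 hR (by linarith) hN.le (h := 2 ^ L)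
      hUX (fun i hi => by have := hU i hi; rw [pow_succ] at this; omega) hspread
      (fun W i hi => (hT W i hi).1) (fun W i hi => (hT W i hi).2.1)
      (fun W i hi => (hT W i hi).2.2.1) (fun W i hi => (hT W i hi).2.2.2)
    have hsmall : (4 / (q * R)) ^ 2 ^ L ≤ (1 / 2 : ℝ) ^ (L + 1) / 32 := by
      have hb : 4 / (q * R) ≤ (1 / 2 : ℝ) ^ 6 := by
        rw [div_le_iff₀ (by positivity)]
        linarith
      calc (4 / (q * R)) ^ 2 ^ L ≤ ((1 / 2 : ℝ) ^ 6) ^ 2 ^ L :=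
            pow_le_pow_left₀ (by positivity) hb _
        _ ≤ ((1 / 2 : ℝ) ^ 6) ^ (L + 1) :=
            pow_le_pow_of_le_one (by positivity) (by norm_num) (Nat.lt_two_pow_self (n := L))
        _ = (1 / 2 : ℝ) ^ (6 * (L + 1)) := by rw [pow_mul]
        _ ≤ (1 / 2 : ℝ) ^ (L + 1 + 5) :=
            pow_le_pow_of_le_one (by positivity) (by norm_num) (by omega)
        _ = _ := by rw [pow_add]; norm_num; ring
    have hunion := bernoulliExp_add_le hq.le hLq (by linarith) X
      (antitone_avoid I U (zero_le_one (α := ℝ)))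
    have hrw : ((L + 1 : ℕ) : ℝ) * q = q + L * q := by push_cast; ring
    rw [hrw]
    refine hunion.trans ((bernoulliExp_mono hq.le hq1 hstep).trans ?_)
    rw [bernoulliExp_affine]
    have h3 : 1 / N * bernoulliExp q X
        (fun W => ((I.filter fun i => 2 ^ L ≤ (T W i).card).card : ℝ)) ≤
        (1 / 2 : ℝ) ^ (L + 1) / 32 := by
      rw [one_div, inv_mul_le_iff₀ hN]
      refine hlarge.trans ?_
      rw [mul_comm N]
      exact mul_le_mul_of_nonneg_right hsmall hN.le
    have h4 : (1 / 2 : ℝ) ^ (L + 1) = (1 / 2) ^ L / 2 := by rw [pow_succ]; ring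
    rw [h4] at h3 ⊢
    linarith

lemma one_sub_sum_le_prod {ι : Type*} (s : Finset ι) (r : ι → ℝ) (h0 : ∀ i ∈ s, 0 ≤ r i)
    (h1 : ∀ i ∈ s, r i ≤ 1) : 1 - ∑ i ∈ s, r i ≤ ∏ i ∈ s, (1 - r i) := by
  induction s using Finset.induction_on with
  | empty => simp
  | insert x s hx ih =>
    rw [Finset.sum_insert hx, Finset.prod_insert hx]
    have e := ih (fun i hi => h0 i (Finset.mem_insert_of_mem hi))
      (fun i hi => h1 i (Finset.mem_insert_of_mem hi))
    have hs : 0 ≤ ∑ i ∈ s, r i := Finset.sum_nonneg fun i hi => h0 i (Finset.mem_insert_of_mem hi)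
    have hx0 := h0 x (Finset.mem_insert_self x s)
    have hx1 := h1 x (Finset.mem_insert_self x s)
    nlinarith [mul_le_mul_of_nonneg_left e (sub_nonneg.2 hx1), mul_nonneg hx0 hs]

lemma sum_prod_update_le {m : ℕ} (hm : 0 < m) (a b : Fin m → ℝ) (ha : ∀ c, 0 < a c)
    (hb : ∀ c, 0 ≤ b c) (hba : ∀ c, b c ≤ a c) :
    ∑ c, ∏ d, Function.update a c (b c) d ≤
      ∑ _c : Fin m, ∏ d, ((1 - (1 / m : ℝ)) * a d + 1 / m * b d) := by
  have hm' : (0 : ℝ) < m := by exact_mod_cast hm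
  have hm1 : (1 : ℝ) ≤ m := by exact_mod_cast hm
  have hr0 : ∀ c, 0 ≤ (1 - b c / a c) / m := fun c =>
    div_nonneg (sub_nonneg.2 ((div_le_one (ha c)).2 (hba c))) hm'.le
  have hr1 : ∀ c, (1 - b c / a c) / m ≤ 1 := fun c => by
    rw [div_le_one hm']
    have := div_nonneg (hb c) (ha c).le
    linarith
  have key := one_sub_sum_le_prod Finset.univ (fun c => (1 - b c / a c) / m)
    (fun c _ => hr0 c) (fun c _ => hr1 c)
  have hprod : 0 ≤ ∏ d, a d := Finset.prod_nonneg fun d _ => (ha d).le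
  have hl : ∀ c, ∏ d, Function.update a c (b c) d = (∏ d, a d) * (b c / a c) := by
    intro c
    rw [Finset.prod_update_of_mem (Finset.mem_univ c),
      ← Finset.mul_prod_erase Finset.univ a (Finset.mem_univ c), Finset.sdiff_singleton_eq_erase]
    have := (ha c).ne'
    field_simp
  have hrr : ∏ d, ((1 - (1 / m : ℝ)) * a d + 1 / m * b d) =
      (∏ d, a d) * ∏ d, (1 - (1 - b d / a d) / m) := by
    rw [← Finset.prod_mul_distrib]
    refine Finset.prod_congr rfl fun d _ => ?_
    have := (ha d).ne'
    field_simp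
    ring
  have hs : ∑ c : Fin m, (1 - b c / a c) / m = 1 - (∑ c, b c / a c) / m := by
    rw [← Finset.sum_div, Finset.sum_sub_distrib]
    simp only [Finset.sum_const, Finset.card_univ, Fintype.card_fin, nsmul_eq_mul, mul_one]
    field_simp
  rw [hs] at key
  simp only [hl, hrr, ← Finset.mul_sum, Finset.sum_const, Finset.card_univ, Fintype.card_fin,
    nsmul_eq_mul]
  have key' : (∑ c, b c / a c) ≤ m * ∏ d, (1 - (1 - b d / a d) / m) := by
    rw [← div_le_iff₀' hm']
    linarith
  nlinarith [mul_le_mul_of_nonneg_left key' hprod]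

/-- The parts of a random partition are negatively correlated, in the following derandomized form:
some choice of disjoint parts does as well as independent random sets of the same density. -/
lemma exists_pairwise_disjoint_sum_prod_le {ι : Type*} [Fintype ι] {m : ℕ} (hm : 0 < m)
    {g : ι → Finset α → ℝ} (hg : ∀ i, Antitone (g i)) (hg1 : ∀ i W, 1 ≤ g i W)
    (X : Finset α) (W : Fin m → Finset α) (hW : ∀ c d, c ≠ d → Disjoint (W c) (W d))
    (hWX : ∀ c, Disjoint (W c) X) :
    ∃ W' : Fin m → Finset α, (∀ c d, c ≠ d → Disjoint (W' c) (W' d)) ∧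
      ∑ i, ∏ c, g i (W' c) ≤
        ∑ i, ∏ c, bernoulliExp (1 / m) X (fun V => g i (W c ∪ V)) := by
  have hm1 : (1 : ℝ) / m ≤ 1 := by
    rw [div_le_one (by exact_mod_cast hm)]
    exact_mod_cast hm
  have hm0 : (0 : ℝ) ≤ 1 / m := by positivity
  induction X using Finset.induction_on generalizing W with
  | empty => exact ⟨W, hW, by simp [bernoulliExp_empty]⟩
  | insert x X hx ih =>
    have hxW : ∀ c, x ∉ W c := fun c h =>
      Finset.disjoint_left.1 (hWX c) h (Finset.mem_insert_self x X)
    have hWX' : ∀ c, Disjoint (W c) X := fun c =>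
      (hWX c).mono_right (Finset.subset_insert x X)
    let a : ι → Fin m → ℝ := fun i c => bernoulliExp (1 / m) X (fun V => g i (W c ∪ V))
    let b : ι → Fin m → ℝ := fun i c => bernoulliExp (1 / m) X (fun V => g i (insert x (W c) ∪ V))
    have hone : ∀ (i : ι) (A : Finset α), 1 ≤ bernoulliExp (1 / m) X (fun V => g i (A ∪ V)) := by
      intro i A
      calc (1 : ℝ) = bernoulliExp (1 / m) X (fun _ => 1) := (bernoulliExp_const _ _ _).symm
        _ ≤ _ := bernoulliExp_mono hm0 hm1 fun V _ => hg1 i _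
    have hba : ∀ i c, b i c ≤ a i c := fun i c =>
      bernoulliExp_mono hm0 hm1 fun V _ =>
        hg i (Finset.union_subset_union_left (Finset.subset_insert x (W c)))
    have hsum : ∑ c, ∑ i, ∏ d, Function.update (a i) c (b i c) d ≤
        ∑ _c : Fin m, ∑ i, ∏ d, bernoulliExp (1 / m) (insert x X) (fun V => g i (W d ∪ V)) := by
      rw [Finset.sum_comm, Finset.sum_comm (s := (Finset.univ : Finset (Fin m)))]
      refine Finset.sum_le_sum fun i _ => ?_
      have := sum_prod_update_le hm (a i) (b i) (fun c => by linarith [hone i (W c)])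
        (fun c => by linarith [hone i (insert x (W c))]) (hba i)
      simpa only [bernoulliExp_insert _ hx, Finset.union_insert, Finset.insert_union, a, b]
        using this
    obtain ⟨c, -, hc⟩ := Finset.exists_le_of_sum_le ⟨⟨0, hm⟩, Finset.mem_univ _⟩ hsum
    obtain ⟨W', hW', hle⟩ := ih (Function.update W c (insert x (W c)))
      (by
        intro d e hde
        by_cases hd : d = c
        · subst hd
          rw [Function.update_self, Function.update_of_ne hde.symm, Finset.disjoint_insert_left]
          exact ⟨hxW e, hW d e hde⟩
        · rw [Function.update_of_ne hd]
          by_cases he : e = c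
          · subst he
            rw [Function.update_self, Finset.disjoint_insert_right]
            exact ⟨hxW d, hW d e hde⟩
          · rw [Function.update_of_ne he]
            exact hW d e hde)
      (by
        intro d
        by_cases hd : d = c
        · subst hd
          rw [Function.update_self, Finset.disjoint_insert_left]
          exact ⟨hx, hWX' d⟩
        · rw [Function.update_of_ne hd]
          exact hWX' d)
    refine ⟨W', hW', hle.trans (le_trans (le_of_eq ?_) hc)⟩
    refine Finset.sum_congr rfl fun i _ => Finset.prod_congr rfl fun d _ => ?_
    by_cases hd : d = c
    · subst hd
      simp only [Function.update_self, b]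
    · simp only [Function.update_of_ne hd, a]

lemma card_famRestrict (G : Finset (Finset α)) (B : Finset α) :
    (famRestrict G B).card = (G.filter fun A => B ⊆ A).card := by
  refine Finset.card_image_of_injOn fun A hA A' hA' h => ?_
  have h1 := (Finset.mem_filter.1 hA).2
  have h2 := (Finset.mem_filter.1 hA').2
  rw [← Finset.sdiff_union_of_subset h1, h, Finset.sdiff_union_of_subset h2]

lemma IsSpread.bernoulliExp_avoid_le {G : Finset (Finset α)} {R : ℝ} (hG : IsSpread R G)
    (hne : G.Nonempty) {s k : ℕ} (hs : 1 ≤ s) (hk : 2 ≤ k)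
    (hR : (2 : ℝ) ^ 13 * s * (Nat.clog 2 k : ℝ) < R) (hcard : ∀ A ∈ G, A.card ≤ k)
    {X : Finset α} (hX : ∀ A ∈ G, A ⊆ X) :
    bernoulliExp (1 / (2 * s : ℕ)) X (fun W => if ∃ A ∈ G, A ⊆ W then 0 else 1) ≤ 1 / 32 := by
  have hc : 1 ≤ Nat.clog 2 k := Nat.clog_pos (by norm_num) hk
  have hs' : (1 : ℝ) ≤ s := by exact_mod_cast hs
  have hc' : (1 : ℝ) ≤ Nat.clog 2 k := by exact_mod_cast hc
  have hR0 : 0 < R := lt_trans (by positivity) hR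
  have hN : (0 : ℝ) < G.card := by exact_mod_cast hne.card_pos
  have hLq : ((Nat.clog 2 k + 1 : ℕ) : ℝ) * (1 / (2 * s * (Nat.clog 2 k + 1))) =
      1 / (2 * s : ℕ) := by
    push_cast
    field_simp
  have hp1 : (1 : ℝ) / (2 * s : ℕ) ≤ 1 := by
    push_cast
    rw [div_le_one (by positivity)]
    linarith
  have hqR : (2 : ℝ) ^ 11 ≤ 1 / (2 * s * (Nat.clog 2 k + 1)) * R := by
    rw [one_div, ← div_eq_inv_mul, le_div_iff₀ (by positivity)]
    nlinarith [mul_le_mul_of_nonneg_left hc' (by positivity : (0 : ℝ) ≤ s)]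
  have key := _root_.bernoulliExp_avoid_le (ι := Finset α)
    (q := 1 / (2 * s * (Nat.clog 2 k + 1))) (by positivity) hR0 hqR hN
    (X := X) (Nat.clog 2 k + 1) (by rw [hLq]; exact hp1) (I := G) (U := id) hX
    (fun A hA => by
      have h1 := hcard A hA
      have h2 := Nat.le_pow_clog (b := 2) (by norm_num) k
      have h3 : 2 ^ Nat.clog 2 k < 2 ^ (Nat.clog 2 k + 1) :=
        Nat.pow_lt_pow_right (by norm_num) (by omega)
      exact lt_of_le_of_lt (h1.trans h2) h3)
    (fun T => by
      have := hG T
      rw [card_famRestrict, zpow_neg, zpow_natCast, ← inv_pow] at this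
      exact this)
  rw [hLq, div_self hN.ne'] at key
  refine le_trans key ?_
  have : (0 : ℝ) ≤ (1 / 2) ^ (Nat.clog 2 k + 1) := by positivity
  linarith

end Spread

/-- Proposition 4.4 (disjoint representatives in spread families). -/
theorem spread_matching {α : Type*} [DecidableEq α] (s k : ℕ) (hs : 1 ≤ s) (hk : 2 ≤ k)
    (R : ℝ) (hR : (2:ℝ)^13 * s * (Nat.clog 2 k : ℝ) < R)
    (G : Fin s → Finset (Finset α))
    (hne : ∀ i, (G i).Nonempty)
    (hunif : ∀ i, ∃ d ≤ k, ∀ A ∈ G i, A.card = d)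
    (hspread : ∀ i, IsSpread R (G i)) :
    ∃ f : Fin s → Finset α, (∀ i, f i ∈ G i) ∧
      ∀ i j, i ≠ j → Disjoint (f i) (f j) := by
  let X : Finset α := Finset.univ.biUnion fun i => (G i).biUnion id
  let g : Fin s → Finset α → ℝ := fun i W => if ∃ A ∈ G i, A ⊆ W then 1 else 16
  have hexp : ∀ i, bernoulliExp (1 / (2 * s : ℕ)) X (g i) ≤ 2 := by
    intro i
    obtain ⟨d, hd, hdc⟩ := hunif i
    have h1 := (hspread i).bernoulliExp_avoid_le (hne i) hs hk hR
      (fun A hA => (hdc A hA).trans_le hd) (X := X)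
      (fun A hA a ha => Finset.mem_biUnion.2
        ⟨i, Finset.mem_univ i, Finset.mem_biUnion.2 ⟨A, hA, ha⟩⟩)
    have h2 : g i = fun W => 1 + 15 * (if ∃ A ∈ G i, A ⊆ W then 0 else 1) := by
      funext W
      simp only [g]
      split_ifs <;> norm_num
    rw [h2, bernoulliExp_affine]
    linarith
  have hnonneg : ∀ i, 0 ≤ bernoulliExp (1 / (2 * s : ℕ)) X (g i) := by
    intro i
    have hp1 : (1 : ℝ) / (2 * s : ℕ) ≤ 1 := by
      rw [div_le_one (by positivity)]
      exact_mod_cast (by omega : 1 ≤ 2 * s)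
    rw [← bernoulliExp_const (1 / (2 * s : ℕ)) X 0]
    refine bernoulliExp_mono (by positivity) hp1 fun W _ => ?_
    simp only [g]
    split_ifs <;> norm_num
  obtain ⟨W, hW, hle⟩ := exists_pairwise_disjoint_sum_prod_le (m := 2 * s) (by omega)
    (fun i => antitone_avoid (G i) id (by norm_num : (1 : ℝ) ≤ 16))
    (fun i W => by split_ifs <;> norm_num) X (fun _ => ∅) (by simp) (by simp)
  simp only [Finset.empty_union, id] at hle
  have hbound : ∑ i, ∏ c, g i (W c) ≤ s * 4 ^ s := by
    refine hle.trans ?_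
    calc _ ≤ ∑ _i : Fin s, (4 : ℝ) ^ s := by
          refine Finset.sum_le_sum fun i _ => ?_
          rw [Finset.prod_const, Finset.card_univ, Fintype.card_fin]
          calc _ ≤ (2 : ℝ) ^ (2 * s) := pow_le_pow_left₀ (hnonneg i) (hexp i) _
            _ = 4 ^ s := by rw [pow_mul]; norm_num
      _ = _ := by simp
  let good : Fin s → Finset (Fin (2 * s)) :=
    fun i => Finset.univ.filter fun c => ∃ A ∈ G i, A ⊆ W c
  have hgood : ∀ i, s ≤ (good i).card := by
    intro i
    by_contra! hlt
    have hprod : ∏ c, g i (W c) =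
        16 ^ (Finset.univ.filter fun c => ¬ ∃ A ∈ G i, A ⊆ W c).card := by
      simp only [g, Finset.prod_ite, Finset.prod_const, one_pow, one_mul]
    have hcard : s ≤ (Finset.univ.filter fun c => ¬ ∃ A ∈ G i, A ⊆ W c).card := by
      have := Finset.card_filter_add_card_filter_not (s := (Finset.univ : Finset (Fin (2 * s))))
        fun c => ∃ A ∈ G i, A ⊆ W c
      rw [Finset.card_univ, Fintype.card_fin] at this
      have h2 : (good i).card = (Finset.univ.filter fun c => ∃ A ∈ G i, A ⊆ W c).card := rfl
      omega
    have h1 : ∏ c, g i (W c) ≤ ∑ i, ∏ c, g i (W c) :=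
      Finset.single_le_sum (f := fun i => ∏ c, g i (W c))
        (fun j _ => Finset.prod_nonneg fun c _ => by
          simp only [g]
          split_ifs <;> norm_num) (Finset.mem_univ i)
    have h2 : (16 : ℝ) ^ s ≤ ∏ c, g i (W c) := by
      rw [hprod]
      exact pow_le_pow_right₀ (by norm_num) hcard
    have h3 : (s : ℝ) < 4 ^ s := by exact_mod_cast Nat.lt_pow_self (by norm_num : 1 < 4)
    have h4 : (s : ℝ) * 4 ^ s < 16 ^ s := by
      calc (s : ℝ) * 4 ^ s < 4 ^ s * 4 ^ s := mul_lt_mul_of_pos_right h3 (by positivity)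
        _ = 16 ^ s := by rw [← mul_pow]; norm_num
    linarith
  obtain ⟨σ, hσ, hσg⟩ := (Finset.all_card_le_biUnion_card_iff_exists_injective good).1 (by
    intro S
    rcases S.eq_empty_or_nonempty with rfl | ⟨i, hi⟩
    · simp
    · calc S.card ≤ s := by simpa using Finset.card_le_univ S
        _ ≤ (good i).card := hgood i
        _ ≤ _ := Finset.card_le_card (Finset.subset_biUnion_of_mem good hi))
  have hmem : ∀ i, ∃ A ∈ G i, A ⊆ W (σ i) := fun i => (Finset.mem_filter.1 (hσg i)).2
  choose f hf hfW using hmem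
  exact ⟨f, hf, fun i j hij => (hW _ _ (hσ.ne hij)).mono (hfW i) (hfW j)⟩
end

section
/- For all integers s ≥ 1 and t ≥ 2, every finite family of t-element sets of size greater than (2^14 · s · log₂ t)^t contains a sunflower with s petals; equivalently, φ(s,t) ≤ (2^14 · s · log₂ t)^t. -/
open Finset
open scoped Classical

variable {γ : Type*}

section Coloring

variable {ι V C : Type*} [Fintype V]

/-- The vertices whose color lies in `A`. -/
noncomputable def colorClass (A : Finset C) (c : V → C) : Finset V :=
  univ.filter fun v => c v ∈ A

lemma mem_colorClass {A : Finset C} {c : V → C} {v : V} :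
    v ∈ colorClass A c ↔ c v ∈ A := by
  simp [colorClass]

/-- Up to the vertices colored by `A`, the set `S` contains a member of the family `f` on `I`
with at most `K` vertices left uncovered. -/
def HasFragment (I : Finset ι) (f : ι → Finset V) (A : Finset C) (K : ℕ) (c : V → C)
    (S : Finset V) : Prop :=
  ∃ i ∈ I, f i ⊆ S ∪ colorClass A c ∧ (f i \ colorClass A c).card ≤ K

/-- Colorings that agree with `c` outside `T`. -/
noncomputable def recolorings [Fintype C] (c : V → C) (T : Finset V) : Finset (V → C) :=
  Fintype.piFinset fun v => if v ∈ T then univ else {c v}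

lemma mem_recolorings [Fintype C] {c d : V → C} {T : Finset V} :
    d ∈ recolorings c T ↔ ∀ v ∉ T, d v = c v := by
  simp only [recolorings, Fintype.mem_piFinset]
  refine forall_congr' fun v => ?_
  by_cases hv : v ∈ T <;> simp [hv]

lemma card_recolorings [Fintype C] (c : V → C) (T : Finset V) :
    (recolorings c T).card = Fintype.card C ^ T.card := by
  rw [recolorings, Fintype.card_piFinset]
  have : ∀ v, (if v ∈ T then (univ : Finset C) else {c v}).card
      = if v ∈ T then Fintype.card C else 1 := by
    intro v; split_ifs <;> simp
  simp [this]

variable [DecidableEq C]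

/-- The members of the family that are covered by `insert a A` and have at most `K`
vertices outside of `A`. -/
noncomputable def coveredIndices (I : Finset ι) (f : ι → Finset V) (A : Finset C) (a : C) (K : ℕ)
    (c : V → C) : Finset ι :=
  I.filter fun i => f i ⊆ colorClass (insert a A) c ∧ (f i \ colorClass A c).card ≤ K

/-- Candidates, determined by the coloring alone, for a minimum fragment of size above `K'`. -/
noncomputable def fragmentCandidates (I : Finset ι) (f : ι → Finset V) (A : Finset C) (a : C)
    (K K' : ℕ) (c : V → C) : Finset (Finset V) :=
  if h : (coveredIndices I f A a K c).Nonempty then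
    (f h.choose \ colorClass A c).powerset.filter fun T => K' < T.card
  else ∅

lemma card_fragmentCandidates_le (I : Finset ι) (f : ι → Finset V) (A : Finset C) (a : C)
    (K K' : ℕ) (c : V → C) : (fragmentCandidates I f A a K K' c).card ≤ 2 ^ K := by
  unfold fragmentCandidates
  split_ifs with h
  · refine (card_filter_le _ _).trans ?_
    rw [card_powerset]
    exact Nat.pow_le_pow_right (by norm_num) (mem_filter.1 h.choose_spec).2.2
  · simp

lemma lt_card_of_mem_fragmentCandidates {I : Finset ι} {f : ι → Finset V} {A : Finset C} {a : C}
    {K K' : ℕ} {c : V → C} {T : Finset V} (hT : T ∈ fragmentCandidates I f A a K K' c) :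
    K' < T.card := by
  unfold fragmentCandidates at hT
  split_ifs at hT with h
  · exact (mem_filter.1 hT).2
  · simp at hT

variable [Fintype C]

/-- A set that loses its fragments when the threshold drops from `K` to `K'` contains a minimum
fragment, which can be recovered after being recolored by the new color. -/
lemma exists_recoloring {I : Finset ι} {f : ι → Finset V} {A : Finset C} {a : C} (ha : a ∉ A)
    {K K' : ℕ} {c : V → C} {S : Finset V} (hS : HasFragment I f A K c S)
    (hS' : ¬ HasFragment I f (insert a A) K' c S) :
    ∃ d : V → C, ∃ T ∈ fragmentCandidates I f A a K K' d, c ∈ recolorings d T ∧ T ⊆ S := by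
  have hne : (I.filter fun i => f i ⊆ S ∪ colorClass (insert a A) c ∧
      (f i \ colorClass A c).card ≤ K).Nonempty := by
    obtain ⟨i, hi, h1, h2⟩ := hS
    refine ⟨i, mem_filter.2 ⟨hi, fun v hv => ?_, h2⟩⟩
    have := h1 hv
    simp only [mem_union, mem_colorClass, mem_insert] at this ⊢
    tauto
  obtain ⟨i, hi, hmin⟩ :=
    exists_min_image _ (fun i => (f i \ colorClass (insert a A) c).card) hne
  obtain ⟨hiI, hiS, hiK⟩ := mem_filter.1 hi
  set T := f i \ colorClass (insert a A) c with hT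
  have hTS : T ⊆ S := by
    intro v hv
    have h1 := mem_sdiff.1 hv
    exact (mem_union.1 (hiS h1.1)).resolve_right h1.2
  have hTK : K' < T.card := by
    by_contra hcon
    exact hS' ⟨i, hiI, hiS, not_lt.1 hcon⟩
  have hTc : ∀ v ∈ T, c v ∉ insert a A := fun v hv h =>
    (mem_sdiff.1 hv).2 (mem_colorClass.2 h)
  let d : V → C := fun v => if v ∈ T then a else c v
  have hdA : colorClass A d = colorClass A c := by
    ext v
    simp only [mem_colorClass, d]
    split_ifs with hv
    · have := hTc v hv
      simp only [mem_insert, not_or] at this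
      simp [ha, this.2]
    · rfl
  have hdA' : colorClass (insert a A) d = colorClass (insert a A) c ∪ T := by
    ext v
    simp only [mem_union, mem_colorClass, d]
    split_ifs with hv <;> simp [hv]
  have hcov : (coveredIndices I f A a K d).Nonempty := by
    refine ⟨i, mem_filter.2 ⟨hiI, ?_, by rwa [hdA]⟩⟩
    rw [hdA']
    intro v hv
    by_cases h : v ∈ colorClass (insert a A) c
    · exact mem_union_left _ h
    · exact mem_union_right _ (mem_sdiff.2 ⟨hv, h⟩)
  refine ⟨d, T, ?_, mem_recolorings.2 fun v hv => by simp [d, hv], hTS⟩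
  rw [fragmentCandidates, dif_pos hcov]
  obtain ⟨hjI, hj, hjK⟩ := mem_filter.1 hcov.choose_spec
  generalize hcov.choose = j at *
  rw [hdA] at hjK ⊢
  rw [hdA'] at hj
  refine mem_filter.2 ⟨mem_powerset.2 ?_, hTK⟩
  have hsub : f j \ colorClass (insert a A) c ⊆ T := fun v hv =>
    (mem_union.1 (hj (mem_sdiff.1 hv).1)).resolve_left (mem_sdiff.1 hv).2
  have hle : T.card ≤ (f j \ colorClass (insert a A) c).card := by
    refine hmin j (mem_filter.2 ⟨hjI, fun v hv => ?_, hjK⟩)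
    rcases mem_union.1 (hj hv) with h | h
    · exact mem_union_right _ h
    · exact mem_union_left _ (hTS h)
  rw [← eq_of_subset_of_card_le hsub hle]
  intro v hv
  have := mem_sdiff.1 hv
  refine mem_sdiff.2 ⟨this.1, fun h => this.2 ?_⟩
  rw [mem_colorClass] at h ⊢
  exact mem_insert_of_mem h

lemma card_fragment_loss_le {I : Finset ι} {f : ι → Finset V} {r q : ℝ} (hr : 0 < r)
    (hI : ∀ T : Finset V, r ^ T.card * (I.filter fun i => T ⊆ f i).card ≤ I.card)
    (hq : (Fintype.card C : ℝ) ≤ q * r) (hq0 : 0 ≤ q) (hq1 : q ≤ 1)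
    {A : Finset C} {a : C} (ha : a ∉ A) (K K' : ℕ) :
    ((((univ : Finset (V → C)) ×ˢ I).filter fun x => HasFragment I f A K x.1 (f x.2) ∧
      ¬ HasFragment I f (insert a A) K' x.1 (f x.2)).card : ℝ) ≤
      2 ^ K * q ^ (K' + 1) * (Fintype.card (V → C) * I.card) := by
  have hterm : ∀ (d : V → C), ∀ T ∈ fragmentCandidates I f A a K K' d,
      (((recolorings d T) ×ˢ (I.filter fun i => T ⊆ f i)).card : ℝ)
        ≤ q ^ (K' + 1) * I.card := by
    intro d T hT
    rw [card_product, card_recolorings]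
    push_cast
    calc (Fintype.card C : ℝ) ^ T.card * (I.filter fun i => T ⊆ f i).card
        ≤ (q * r) ^ T.card * (I.filter fun i => T ⊆ f i).card := by gcongr
      _ = q ^ T.card * (r ^ T.card * (I.filter fun i => T ⊆ f i).card) := by
          rw [mul_pow]; ring
      _ ≤ q ^ (K' + 1) * I.card := by
          gcongr ?_ * ?_
          · exact pow_le_pow_of_le_one hq0 hq1 (lt_card_of_mem_fragmentCandidates hT)
          · exact hI T
  have hsub : (((univ : Finset (V → C)) ×ˢ I).filter fun x => HasFragment I f A K x.1 (f x.2) ∧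
      ¬ HasFragment I f (insert a A) K' x.1 (f x.2)) ⊆
      (univ : Finset (V → C)).biUnion fun d => (fragmentCandidates I f A a K K' d).biUnion fun T =>
        (recolorings d T) ×ˢ (I.filter fun i => T ⊆ f i) := by
    rintro ⟨c, i⟩ hx
    obtain ⟨hi, h1, h2⟩ := mem_filter.1 hx
    obtain ⟨d, T, hT, hc, hTi⟩ := exists_recoloring ha h1 h2
    simp only [mem_biUnion, mem_product, mem_filter]
    exact ⟨d, mem_univ _, T, hT, hc, (mem_product.1 hi).2, hTi⟩
  have hcard := (card_le_card hsub).trans (card_biUnion_le.trans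
    (sum_le_sum fun d _ => card_biUnion_le))
  calc _ ≤ ((∑ d : V → C, ∑ T ∈ fragmentCandidates I f A a K K' d,
        ((recolorings d T) ×ˢ (I.filter fun i => T ⊆ f i)).card : ℕ) : ℝ) := by
          exact_mod_cast hcard
    _ ≤ ∑ d : V → C, ∑ T ∈ fragmentCandidates I f A a K K' d, q ^ (K' + 1) * (I.card : ℝ) := by
          push_cast only [Nat.cast_sum]
          exact sum_le_sum fun d _ => sum_le_sum fun T hT => hterm d T hT
    _ ≤ ∑ d : V → C, 2 ^ K * (q ^ (K' + 1) * (I.card : ℝ)) := by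
          refine sum_le_sum fun d _ => ?_
          rw [sum_const, nsmul_eq_mul]
          gcongr
          exact_mod_cast card_fragmentCandidates_le I f A a K K' d
    _ = _ := by
          rw [sum_const, nsmul_eq_mul, card_univ]; ring

end Coloring

lemma log_le_div_two_pow_add {t l : ℕ} (ht : t ≠ 0) :
    Nat.log 2 t ≤ t / 2 ^ (l + 1) + l := by
  rcases le_or_gt (Nat.log 2 t) l with h | h
  · exact h.trans (Nat.le_add_left _ _)
  · obtain ⟨n, hn⟩ := Nat.exists_eq_add_of_lt h
    have h1 : 2 ^ n * 2 ^ (l + 1) ≤ t := by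
      rw [← pow_add]
      calc 2 ^ (n + (l + 1)) = 2 ^ Nat.log 2 t := by rw [hn]; congr 1; ring
        _ ≤ t := Nat.pow_log_le_self 2 ht
    have h2 : 2 ^ n ≤ t / 2 ^ (l + 1) := (Nat.le_div_iff_mul_le (by positivity)).2 h1
    have h3 : n < 2 ^ n := Nat.lt_two_pow_self
    omega

section Blocks

variable {ι V β : Type*} [Fintype V] [Fintype β]

/-- The first `l` colors of the block `b`. -/
noncomputable def blockColors (m : ℕ) (b : β) (l : ℕ) : Finset (β × Fin m) :=
  univ.filter fun x => x.1 = b ∧ x.2.val < l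

lemma insert_blockColors {m l : ℕ} (b : β) (hl : l < m) :
    insert (b, ⟨l, hl⟩) (blockColors m b l) = blockColors m b (l + 1) := by
  ext ⟨x, y⟩
  simp only [blockColors, mem_insert, mem_filter, mem_univ, true_and, Prod.mk.injEq, Fin.ext_iff]
  constructor
  · rintro (⟨h1, h2⟩ | ⟨h1, h2⟩) <;> exact ⟨h1, by omega⟩
  · rintro ⟨h1, h2⟩
    by_cases h : y.val = l
    · exact Or.inl ⟨h1, h⟩
    · exact Or.inr ⟨h1, by omega⟩

lemma card_not_hasFragment_le {I : Finset ι} {f : ι → Finset V} {r : ℝ} (hr : 0 < r) {t m : ℕ}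
    (ht : t ≠ 0) (hm : m = Nat.log 2 t + 1) (hf : ∀ i ∈ I, (f i).card ≤ t)
    (hI : ∀ T : Finset V, r ^ T.card * (I.filter fun i => T ⊆ f i).card ≤ I.card)
    (hN : 16 * (Fintype.card (β × Fin m) : ℝ) ≤ r) (b : β) (l : ℕ) (hl : l ≤ m) :
    ((((univ : Finset (V → β × Fin m)) ×ˢ I).filter fun x =>
      ¬ HasFragment I f (blockColors m b l) (t / 2 ^ l) x.1 (f x.2)).card : ℝ) ≤
      1 / 2 * (1 / 4) ^ (m - l) * (Fintype.card (V → β × Fin m) * I.card) := by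
  induction l with
  | zero =>
    have : (((univ : Finset (V → β × Fin m)) ×ˢ I).filter fun x =>
      ¬ HasFragment I f (blockColors m b 0) (t / 2 ^ 0) x.1 (f x.2)) = ∅ := by
      refine filter_eq_empty_iff.2 ?_
      rintro ⟨c, i⟩ hi
      have hi := (mem_product.1 hi).2
      rw [not_not]
      exact ⟨i, hi, subset_union_left,
        (card_le_card sdiff_subset).trans (by simpa using hf i hi)⟩
    rw [this]
    simp only [card_empty, Nat.cast_zero]
    positivity
  | succ l ih =>
    have hlm : l < m := hl
    have ih := ih hlm.le
    have hb : (b, (⟨l, hlm⟩ : Fin m)) ∉ blockColors m b l := by simp [blockColors]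
    have hloss := card_fragment_loss_le (q := 1 / 16) hr hI (by linarith) (by norm_num)
      (by norm_num) hb (t / 2 ^ l) (t / 2 ^ (l + 1))
    rw [insert_blockColors] at hloss
    set e := t / 2 ^ (l + 1) with he
    have hdiv : t / 2 ^ l ≤ 2 * e + 1 := by
      rw [he, pow_succ, ← Nat.div_div_eq_div_mul]
      omega
    have hexp : m - l ≤ e + 1 := by
      have := log_le_div_two_pow_add (l := l) ht
      omega
    have hsmall : (2 : ℝ) ^ (t / 2 ^ l) * (1 / 16) ^ (e + 1) ≤ (1 / 4) ^ (m - l) := by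
      calc (2 : ℝ) ^ (t / 2 ^ l) * (1 / 16) ^ (e + 1)
          ≤ 2 ^ (2 * (e + 1)) * (1 / 16) ^ (e + 1) := by
            gcongr
            · norm_num
            · omega
        _ = (1 / 4) ^ (e + 1) := by
            rw [pow_mul, ← mul_pow]; norm_num
        _ ≤ (1 / 4) ^ (m - l) := pow_le_pow_of_le_one (by norm_num) (by norm_num) hexp
    have hpow : (1 / 4 : ℝ) ^ (m - l) = 1 / 4 * (1 / 4) ^ (m - (l + 1)) := by
      rw [← pow_succ']; congr 1; omega
    have hsub : (((univ : Finset (V → β × Fin m)) ×ˢ I).filter fun x =>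
        ¬ HasFragment I f (blockColors m b (l + 1)) e x.1 (f x.2)) ⊆
        (((univ : Finset (V → β × Fin m)) ×ˢ I).filter fun x =>
          ¬ HasFragment I f (blockColors m b l) (t / 2 ^ l) x.1 (f x.2)) ∪
        (((univ : Finset (V → β × Fin m)) ×ˢ I).filter fun x =>
          HasFragment I f (blockColors m b l) (t / 2 ^ l) x.1 (f x.2) ∧
          ¬ HasFragment I f (blockColors m b (l + 1)) e x.1 (f x.2)) := by
      intro x hx
      simp only [mem_union, mem_filter] at hx ⊢
      tauto
    have hcard : ((((univ : Finset (V → β × Fin m)) ×ˢ I).filter fun x =>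
        ¬ HasFragment I f (blockColors m b (l + 1)) e x.1 (f x.2)).card : ℝ) ≤ _ :=
      Nat.cast_le.2 ((card_le_card hsub).trans (card_union_le _ _))
    rw [Nat.cast_add] at hcard
    have hM : (0 : ℝ) ≤ Fintype.card (V → β × Fin m) * I.card := by positivity
    have h1 := mul_le_mul_of_nonneg_right hsmall hM
    rw [hpow] at ih h1
    have h2 : (0 : ℝ) ≤ (1 / 4) ^ (m - (l + 1)) * (Fintype.card (V → β × Fin m) * I.card) := by
      positivity
    linarith

lemma card_uncovered_le {I : Finset ι} {f : ι → Finset V} {r : ℝ} (hr : 0 < r) {t m : ℕ}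
    (ht : t ≠ 0) (hm : m = Nat.log 2 t + 1) (hne : I.Nonempty) (hf : ∀ i ∈ I, (f i).card ≤ t)
    (hI : ∀ T : Finset V, r ^ T.card * (I.filter fun i => T ⊆ f i).card ≤ I.card)
    (hN : 16 * (Fintype.card (β × Fin m) : ℝ) ≤ r) (b : β) :
    2 * ((univ : Finset (V → β × Fin m)).filter fun c =>
      ¬ ∃ i ∈ I, ∀ v ∈ f i, (c v).1 = b).card ≤ Fintype.card (V → β × Fin m) := by
  have h := card_not_hasFragment_le hr ht hm hf hI hN b m le_rfl
  have hzero : t / 2 ^ m = 0 :=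
    Nat.div_eq_of_lt (hm ▸ Nat.lt_pow_succ_log_self (by norm_num) t)
  have hsub : ((univ : Finset (V → β × Fin m)).filter fun c =>
      ¬ ∃ i ∈ I, ∀ v ∈ f i, (c v).1 = b) ×ˢ I ⊆
      ((univ : Finset (V → β × Fin m)) ×ˢ I).filter fun x =>
        ¬ HasFragment I f (blockColors m b m) (t / 2 ^ m) x.1 (f x.2) := by
    rintro ⟨c, i⟩ hx
    obtain ⟨hc, hi⟩ := mem_product.1 hx
    refine mem_filter.2 ⟨mem_product.2 ⟨mem_univ _, hi⟩, ?_⟩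
    rintro ⟨j, hj, -, hcard⟩
    refine (mem_filter.1 hc).2 ⟨j, hj, fun v hv => ?_⟩
    rw [hzero, Nat.le_zero, card_eq_zero, sdiff_eq_empty_iff_subset] at hcard
    have := mem_colorClass.1 (hcard hv)
    exact (mem_filter.1 this).2.1
  have hle := (Nat.cast_le (α := ℝ)).2 (card_le_card hsub)
  rw [card_product, Nat.cast_mul] at hle
  have hpos : (0 : ℝ) < I.card := by exact_mod_cast hne.card_pos
  have h3 := hle.trans h
  rw [Nat.sub_self, pow_zero, mul_one, ← mul_assoc] at h3
  have h4 := le_of_mul_le_mul_right h3 hpos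
  have h5 : (2 : ℝ) * ((univ : Finset (V → β × Fin m)).filter fun c =>
      ¬ ∃ i ∈ I, ∀ v ∈ f i, (c v).1 = b).card ≤ Fintype.card (V → β × Fin m) := by linarith
  exact_mod_cast h5

/-- A spread family contains members inside at least half of the blocks of a suitable
coloring. -/
lemma exists_coloring_many_covered {I : Finset ι} {f : ι → Finset V} {r : ℝ} (hr : 0 < r)
    {t m : ℕ} (ht : t ≠ 0) (hm : m = Nat.log 2 t + 1) (hne : I.Nonempty)
    (hf : ∀ i ∈ I, (f i).card ≤ t)
    (hI : ∀ T : Finset V, r ^ T.card * (I.filter fun i => T ⊆ f i).card ≤ I.card)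
    (hN : 16 * (Fintype.card (β × Fin m) : ℝ) ≤ r) [Nonempty β] :
    ∃ (g : V → β) (Q : Finset β), Fintype.card β ≤ 2 * Q.card ∧
      ∀ b ∈ Q, ∃ i ∈ I, ∀ v ∈ f i, g v = b := by
  have : Nonempty (Fin m) := ⟨⟨0, by omega⟩⟩
  let bad : (V → β × Fin m) → Finset β := fun c =>
    univ.filter fun b => ¬ ∃ i ∈ I, ∀ v ∈ f i, (c v).1 = b
  have hswap : ∑ c, (bad c).card = ∑ b : β, ((univ : Finset (V → β × Fin m)).filter fun c =>
      ¬ ∃ i ∈ I, ∀ v ∈ f i, (c v).1 = b).card := by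
    simp only [bad, card_filter]
    exact sum_comm
  have hsum : ∑ c, 2 * (bad c).card ≤ ∑ c : V → β × Fin m, Fintype.card β := by
    rw [← mul_sum, hswap, mul_sum, sum_const, smul_eq_mul, card_univ]
    calc _ ≤ ∑ b : β, Fintype.card (V → β × Fin m) :=
          sum_le_sum fun b _ => card_uncovered_le hr ht hm hne hf hI hN b
      _ = _ := by rw [sum_const, smul_eq_mul, card_univ, mul_comm]
  obtain ⟨c, -, hc⟩ := exists_le_of_sum_le univ_nonempty hsum
  refine ⟨fun v => (c v).1, univ.filter fun b => ∃ i ∈ I, ∀ v ∈ f i, (c v).1 = b, ?_,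
    fun b hb => (mem_filter.1 hb).2⟩
  have := card_filter_add_card_filter_not (s := (univ : Finset β))
    (fun b => ∃ i ∈ I, ∀ v ∈ f i, (c v).1 = b)
  rw [card_univ] at this
  change 2 * (univ.filter fun b => ¬ ∃ i ∈ I, ∀ v ∈ f i, (c v).1 = b).card ≤ _ at hc
  omega

end Blocks

/-- The analogue of `exists_coloring_many_covered` for a family on a ground set that need
not be finite. -/
lemma exists_partition_many_covered {ι V β : Type*} [Fintype β] {I : Finset ι}
    {f : ι → Finset V} {r : ℝ} (hr : 0 < r)
    {t m : ℕ} (ht : t ≠ 0) (hm : m = Nat.log 2 t + 1) (hne : I.Nonempty)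
    (hf : ∀ i ∈ I, (f i).card ≤ t)
    (hI : ∀ T : Finset V, r ^ T.card * (I.filter fun i => T ⊆ f i).card ≤ I.card)
    (hN : 16 * (Fintype.card (β × Fin m) : ℝ) ≤ r) [Nonempty β] :
    ∃ (g : V → β) (Q : Finset β), Fintype.card β ≤ 2 * Q.card ∧
      ∀ b ∈ Q, ∃ i ∈ I, ∀ v ∈ f i, g v = b := by
  let U := I.biUnion f
  let f' : ι → Finset {x // x ∈ U} := fun i => (f i).subtype (· ∈ U)
  have hcard : ∀ i, (f' i).card ≤ (f i).card := fun i => by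
    rw [card_subtype]
    exact card_filter_le _ _
  obtain ⟨g, Q, hQ, hg⟩ : ∃ (g : {x // x ∈ U} → β) (Q : Finset β), Fintype.card β ≤ 2 * Q.card ∧
      ∀ b ∈ Q, ∃ i ∈ I, ∀ v ∈ f' i, g v = b := by
    refine exists_coloring_many_covered hr ht hm hne (fun i hi => (hcard i).trans (hf i hi))
      (fun T => ?_) hN
    refine le_trans ?_ (hI (T.map (Function.Embedding.subtype (· ∈ U))))
    rw [card_map]
    refine mul_le_mul_of_nonneg_left (Nat.cast_le.2 (card_le_card fun i hi => ?_)) (by positivity)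
    obtain ⟨hiI, hi⟩ := (@mem_filter _ _ (_) _ _).1 hi
    refine mem_filter.2 ⟨hiI, fun v hv => ?_⟩
    obtain ⟨w, hw, rfl⟩ := mem_map.1 hv
    exact mem_subtype.1 (hi hw)
  refine ⟨fun v => if h : v ∈ U then g ⟨v, h⟩ else Classical.arbitrary β, Q, hQ, fun b hb => ?_⟩
  obtain ⟨i, hi, h⟩ := hg b hb
  refine ⟨i, hi, fun v hv => ?_⟩
  have hvU : v ∈ U := mem_biUnion.2 ⟨i, hi, hv⟩
  rw [← h ⟨v, hvU⟩ (mem_subtype.2 hv)]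
  exact dif_pos hvU

/-- Some link of a family with more than `r ^ t` members is `r`-spread. -/
lemma exists_spread_link {α : Type*} (F : Finset (Finset α)) {r : ℝ} (hr : 0 < r) {t : ℕ}
    (hF : r ^ t < F.card) :
    ∃ X : Finset α, r ^ t < r ^ X.card * (F.filter fun S => X ⊆ S).card ∧
      ∀ T, Disjoint X T → r ^ T.card * (F.filter fun S => X ∪ T ⊆ S).card ≤
        (F.filter fun S => X ⊆ S).card := by
  obtain ⟨X, hX, hmax⟩ := exists_max_image (F.biUnion id).powerset
    (fun X => r ^ X.card * ((F.filter fun S => X ⊆ S).card : ℝ)) ⟨∅, empty_mem_powerset _⟩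
  refine ⟨X, ?_, fun T hT => ?_⟩
  · have := hmax ∅ (empty_mem_powerset _)
    simp only [card_empty, pow_zero, one_mul, empty_subset, filter_true] at this
    exact hF.trans_le this
  · rcases (F.filter fun S => X ∪ T ⊆ S).eq_empty_or_nonempty with h | ⟨S, hS⟩
    · simp [h]
    · obtain ⟨hSF, hS⟩ := mem_filter.1 hS
      have := hmax (X ∪ T) (mem_powerset.2 (hS.trans (subset_biUnion_of_mem id hSF)))
      rw [card_union_of_disjoint hT, pow_add, mul_assoc] at this
      exact le_of_mul_le_mul_left this (by positivity)

lemma isSunflower_of_inter_eq {α : Type*} [DecidableEq α] {P : Finset (Finset α)}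
    (hP : P.Nonempty) {X : Finset α} (hX : ∀ A ∈ P, X ⊆ A)
    (hPX : ∀ A ∈ P, ∀ B ∈ P, A ≠ B → A ∩ B ⊆ X) :
    IsSunflower P P.card (P.inf' hP id) := by
  refine ⟨rfl, hP, rfl, fun A hA B hB hAB => ?_⟩
  refine le_antisymm ((hPX A hA B hB hAB).trans (le_inf' hP _ hX)) ?_
  exact le_inf (inf'_le id hA) (inf'_le id hB)

lemma exists_isSunflower {α : Type*} (F : Finset (Finset α)) {s t : ℕ}
    (hs : 1 ≤ s) (ht : 2 ≤ t) (hFt : ∀ A ∈ F, A.card = t)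
    (hF : ((2:ℝ)^14 * s * Real.logb 2 t)^t < (F.card : ℝ)) :
    ∃ P ⊆ F, ∃ K : Finset α, IsSunflower P s K := by
  have hlog : 1 ≤ Real.logb 2 t := by
    rw [Real.le_logb_iff_rpow_le (by norm_num) (by positivity)]
    simpa using (by exact_mod_cast ht : (2 : ℝ) ≤ t)
  have hs' : (1 : ℝ) ≤ s := by exact_mod_cast hs
  set r : ℝ := (2:ℝ)^14 * s * Real.logb 2 t with hr_def
  have hr : 0 < r := by positivity
  have hN : 16 * (Fintype.card (Fin (2 * s) × Fin (Nat.log 2 t + 1)) : ℝ) ≤ r := by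
    simp only [Fintype.card_prod, Fintype.card_fin]
    push_cast
    have h1 : (Nat.log 2 t : ℝ) ≤ Real.logb 2 t := Real.natLog_le_logb t 2
    have h2 : (s : ℝ) * (Nat.log 2 t + 1) ≤ s * (2 * Real.logb 2 t) := by
      gcongr; linarith
    have h3 : (0 : ℝ) ≤ s * Real.logb 2 t := by positivity
    rw [hr_def]
    linarith
  clear_value r
  obtain ⟨X, hX, hspread⟩ := exists_spread_link F hr hF
  set I := F.filter fun S => X ⊆ S with hI
  have hne : I.Nonempty := by
    rw [nonempty_iff_ne_empty]
    intro h
    rw [h] at hX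
    simp only [card_empty, Nat.cast_zero, mul_zero] at hX
    exact absurd hX (not_lt.2 (by positivity))
  have hproper : ∀ S ∈ I, ¬ S ⊆ X := by
    intro S hS hSX
    obtain ⟨hSF, hXS⟩ := mem_filter.1 hS
    have hXt : X.card = t := by rw [hXS.antisymm hSX, hFt S hSF]
    have hI1 : I.card ≤ 1 := card_le_one.2 fun A hA B hB => by
      have hA := mem_filter.1 hA
      have hB := mem_filter.1 hB
      rw [← eq_of_subset_of_card_le hA.2 (by rw [hFt A hA.1, hXt]),
        ← eq_of_subset_of_card_le hB.2 (by rw [hFt B hB.1, hXt])]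
    rw [hXt] at hX
    have : (I.card : ℝ) ≤ 1 := by exact_mod_cast hI1
    have h2 := mul_le_mul_of_nonneg_left this (pow_pos hr t).le
    linarith
  have hf : ∀ S ∈ I, (S \ X).card ≤ t := fun S hS =>
    (card_le_card sdiff_subset).trans (hFt S (mem_filter.1 hS).1).le
  have hfI : ∀ T, r ^ T.card * (I.filter fun S => T ⊆ S \ X).card ≤ I.card := by
    intro T
    rcases (I.filter fun S => T ⊆ S \ X).eq_empty_or_nonempty with h | ⟨S, hS⟩
    · simp [h]
    · have hdisj : Disjoint X T := disjoint_sdiff.mono_right (mem_filter.1 hS).2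
      refine le_trans ?_ (hspread T hdisj)
      refine mul_le_mul_of_nonneg_left (Nat.cast_le.2 (card_le_card fun A hA => ?_))
        (by positivity)
      obtain ⟨hAI, hA⟩ := mem_filter.1 hA
      obtain ⟨hAF, hAX⟩ := mem_filter.1 hAI
      exact mem_filter.2 ⟨hAF, union_subset hAX (hA.trans sdiff_subset)⟩
  have : Nonempty (Fin (2 * s)) := ⟨⟨0, by omega⟩⟩
  obtain ⟨g, Q', hg, hQ'⟩ := exists_partition_many_covered hr (by omega) rfl hne hf hfI hN
  rw [Fintype.card_fin] at hg
  obtain ⟨Q, hQ, hQs⟩ := exists_subset_card_eq (Nat.le_of_mul_le_mul_left hg (by norm_num))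
  have hex : ∀ b : Fin (2 * s), ∃ S, b ∈ Q → S ∈ I ∧ ∀ v ∈ S \ X, g v = b := by
    intro b
    by_cases hb : b ∈ Q
    · obtain ⟨S, hS, h⟩ := hQ' b (hQ hb)
      exact ⟨S, fun _ => ⟨hS, h⟩⟩
    · exact ⟨∅, fun h => absurd h hb⟩
  choose p hp using hex
  have hinter : ∀ b ∈ Q, ∀ b' ∈ Q, b ≠ b' → p b ∩ p b' ⊆ X := by
    intro b hb b' hb' hbb' v hv
    by_contra hvX
    obtain ⟨hv1, hv2⟩ := mem_inter.1 hv
    exact hbb' (((hp b hb).2 v (mem_sdiff.2 ⟨hv1, hvX⟩)).symm.trans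
      ((hp b' hb').2 v (mem_sdiff.2 ⟨hv2, hvX⟩)))
  have hinj : Set.InjOn p Q := by
    intro b hb b' hb' h
    by_contra hbb'
    refine hproper (p b) (hp b hb).1 ?_
    have := hinter b hb b' hb' hbb'
    rwa [← h, inter_self] at this
  have hcard : (Q.image p).card = s := by rw [card_image_of_injOn hinj, hQs]
  have hP : (Q.image p).Nonempty := card_pos.1 (by omega)
  refine ⟨Q.image p, ?_, (Q.image p).inf' hP id, ?_⟩
  · intro A hA
    obtain ⟨b, hb, rfl⟩ := mem_image.1 hA
    exact (mem_filter.1 (hp b hb).1).1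
  · have := isSunflower_of_inter_eq hP (X := X) ?_ ?_
    · rwa [hcard] at this
    · intro A hA
      obtain ⟨b, hb, rfl⟩ := mem_image.1 hA
      exact (mem_filter.1 (hp b hb).1).2
    · intro A hA B hB hAB
      obtain ⟨b, hb, rfl⟩ := mem_image.1 hA
      obtain ⟨b', hb', rfl⟩ := mem_image.1 hB
      exact hinter b hb b' hb' fun h => hAB (by rw [h])

/-- Claim 4.5: `φ(s,t) ≤ (2^14 s log₂ t)^t`. -/
theorem phi_upper_bound (s t : ℕ) (hs : 1 ≤ s) (ht : 2 ≤ t) :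
    (∀ (α : Type) [DecidableEq α] (F : Finset (Finset α)),
      (∀ A ∈ F, A.card = t) → ((2:ℝ)^14 * s * Real.logb 2 t)^t < (F.card : ℝ) →
      ∃ P ⊆ F, ∃ K : Finset α, IsSunflower P s K) ∧
    (phi s t : ℝ) ≤ ((2:ℝ)^14 * s * Real.logb 2 t)^t := by
  refine ⟨fun α inst F hFt hF => ?_, ?_⟩
  · obtain rfl : inst = fun a b => Classical.propDecidable (a = b) := Subsingleton.elim _ _
    exact exists_isSunflower F hs ht hFt hF
  have hbound : ∀ m ∈ {m : ℕ | ∃ F : Finset (Finset ℕ),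
      (∀ A ∈ F, A.card = t) ∧ SunflowerFree F s ∧ F.card = m},
      (m : ℝ) ≤ ((2:ℝ)^14 * s * Real.logb 2 t)^t := by
    rintro m ⟨F, hFt, hfree, rfl⟩
    by_contra hcon
    obtain ⟨P, hPF, K, hK⟩ := exists_isSunflower F hs ht hFt (not_le.1 hcon)
    refine hfree P hPF K ?_
    convert hK
  refine hbound _ (Nat.sSup_mem ⟨0, ∅, by simp, ?_, rfl⟩
    ⟨_, fun m hm => Nat.le_floor (hbound m hm)⟩)
  rintro P hP K ⟨-, hne, -⟩
  exact hne.ne_empty (subset_empty.1 hP)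
end

section
/- Let τ ≥ 1 be a real number and let F ⊆ 2^{[n]} be an upward closed family that is τ-global with respect to the p-biased measure μ_p, where p ∈ (0, 2^{−7}/τ). Set p̃ = 2^6 · τ · p. Then μ_{p̃}(F) ≥ (μ_p(F))^{3/4}. -/
open Finset
open scoped Classical

variable {γ : Type*}

/-- The `p`-biased weight of a family `F` on a ground set of size `m`:
`μ_p(F) = Σ_{A ∈ F} p^{|A|} (1-p)^{m-|A|}`. -/
noncomputable def muB (m : ℕ) (p : ℝ) (F : Finset (Finset ℕ)) : ℝ :=
  ∑ A ∈ F, p ^ A.card * (1 - p) ^ (m - A.card)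

/-- `F(A, B) = {F \ B : F ∈ F, F ∩ B = A}`. -/
def famRestrict2 (F : Finset (Finset ℕ)) (A B : Finset ℕ) : Finset (Finset ℕ) :=
  (F.filter fun S => S ∩ B = A).image fun S => S \ B

/-- `F` is `τ`-global with respect to the `p`-biased measure on subsets of the ground
set `W`: for all `A ⊆ B ⊆ W`, `μ_p^{-B}(F(A,B)) ≤ τ^{|B|} μ_p(F)`. -/
noncomputable def IsGlobalOn (W : Finset ℕ) (p τ : ℝ) (F : Finset (Finset ℕ)) : Prop :=
  ∀ A B : Finset ℕ, A ⊆ B → B ⊆ W →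
    muB (W.card - B.card) p (famRestrict2 F A B) ≤ τ ^ B.card * muB W.card p F

/-- The expectation of `f` at a `p`-random subset of `W`. -/
noncomputable def biasedExp (p : ℝ) (W : Finset ℕ) (f : Finset ℕ → ℝ) : ℝ :=
  ∑ A ∈ W.powerset, p ^ A.card * (1 - p) ^ (W.card - A.card) * f A

/-- The iterated discrete derivative of `f` in the directions of `S`, up to sign. -/
noncomputable def discreteDeriv (S : Finset ℕ) (f : Finset ℕ → ℝ) (X : Finset ℕ) : ℝ :=
  ∑ A ∈ S.powerset, (-1) ^ A.card * f (X ∪ A)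

lemma biasedExp_insert (p : ℝ) {W : Finset ℕ} {i : ℕ} (hi : i ∉ W) (f : Finset ℕ → ℝ) :
    biasedExp p (insert i W) f =
      (1 - p) * biasedExp p W f + p * biasedExp p W fun A => f (insert i A) := by
  unfold biasedExp
  rw [Finset.sum_powerset_insert hi, Finset.mul_sum, Finset.mul_sum]
  congr 1 <;> refine Finset.sum_congr rfl fun A hA => ?_
  · have h := Finset.card_le_card (Finset.mem_powerset.1 hA)
    rw [Finset.card_insert_of_notMem hi, Nat.sub_add_comm h, pow_succ]
    ring
  · have hA' : i ∉ A := fun h => hi (Finset.mem_powerset.1 hA h)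
    rw [Finset.card_insert_of_notMem hi, Finset.card_insert_of_notMem hA',
      Nat.add_sub_add_right, pow_succ]
    ring

lemma biasedExp_congr (p : ℝ) {W : Finset ℕ} {f g : Finset ℕ → ℝ}
    (h : ∀ A ⊆ W, f A = g A) : biasedExp p W f = biasedExp p W g :=
  Finset.sum_congr rfl fun A hA => by rw [h A (Finset.mem_powerset.1 hA)]

lemma biasedExp_mono {p : ℝ} (h0 : 0 ≤ p) (h1 : p ≤ 1) {W : Finset ℕ} {f g : Finset ℕ → ℝ}
    (h : ∀ A ⊆ W, f A ≤ g A) : biasedExp p W f ≤ biasedExp p W g := by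
  have h2 : 0 ≤ 1 - p := by linarith
  exact Finset.sum_le_sum fun A hA =>
    mul_le_mul_of_nonneg_left (h A (Finset.mem_powerset.1 hA)) (by positivity)

lemma biasedExp_nonneg {p : ℝ} (h0 : 0 ≤ p) (h1 : p ≤ 1) {W : Finset ℕ} {f : Finset ℕ → ℝ}
    (h : ∀ A ⊆ W, 0 ≤ f A) : 0 ≤ biasedExp p W f := by
  have h2 : 0 ≤ 1 - p := by linarith
  exact Finset.sum_nonneg fun A hA =>
    mul_nonneg (by positivity) (h A (Finset.mem_powerset.1 hA))

lemma biasedExp_add (p : ℝ) (W : Finset ℕ) (f g : Finset ℕ → ℝ) :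
    biasedExp p W (fun A => f A + g A) = biasedExp p W f + biasedExp p W g := by
  simp only [biasedExp, mul_add, Finset.sum_add_distrib]

lemma biasedExp_const_mul (p : ℝ) (W : Finset ℕ) (c : ℝ) (f : Finset ℕ → ℝ) :
    biasedExp p W (fun A => c * f A) = c * biasedExp p W f := by
  simp only [biasedExp, Finset.mul_sum]
  exact Finset.sum_congr rfl fun A _ => by ring

lemma biasedExp_sum (p : ℝ) (W : Finset ℕ) {ι : Type*} (s : Finset ι)
    (f : ι → Finset ℕ → ℝ) :
    biasedExp p W (fun A => ∑ j ∈ s, f j A) = ∑ j ∈ s, biasedExp p W (f j) := by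
  simp only [biasedExp, Finset.mul_sum]
  exact Finset.sum_comm

lemma biasedExp_const (p : ℝ) (W : Finset ℕ) (c : ℝ) : biasedExp p W (fun _ => c) = c := by
  induction W using Finset.induction_on with
  | empty => simp [biasedExp]
  | insert i W hi ih => rw [biasedExp_insert p hi, ih]; ring

/-- A `q`-random subset of an `r`-random set is a `(r * q)`-random set. -/
lemma biasedExp_biasedExp (r q : ℝ) (W : Finset ℕ) (f : Finset ℕ → ℝ) :
    biasedExp r W (fun Y => biasedExp q Y f) = biasedExp (r * q) W f := by
  induction W using Finset.induction_on generalizing f with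
  | empty => simp [biasedExp]
  | insert i W hi ih =>
    have h : biasedExp r W (fun Y => biasedExp q (insert i Y) f) =
        (1 - q) * biasedExp (r * q) W f + q * biasedExp (r * q) W fun A => f (insert i A) := by
      rw [← ih, ← ih, ← biasedExp_const_mul, ← biasedExp_const_mul, ← biasedExp_add]
      exact biasedExp_congr r fun Y hY => biasedExp_insert q (fun h => hi (hY h)) f
    rw [biasedExp_insert r hi, biasedExp_insert (r * q) hi, h, ih]
    ring

lemma discreteDeriv_insert {S : Finset ℕ} {i : ℕ} (hi : i ∉ S) (f : Finset ℕ → ℝ)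
    (X : Finset ℕ) :
    discreteDeriv (insert i S) f X = -discreteDeriv S (fun A => f (insert i A) - f A) X := by
  unfold discreteDeriv
  rw [Finset.sum_powerset_insert hi, ← Finset.sum_add_distrib, ← Finset.sum_neg_distrib]
  refine Finset.sum_congr rfl fun A hA => ?_
  rw [Finset.card_insert_of_notMem fun h => hi (Finset.mem_powerset.1 hA h), pow_succ,
    Finset.union_insert]
  ring

lemma discreteDeriv_comp_insert (S : Finset ℕ) (i : ℕ) (f : Finset ℕ → ℝ) (X : Finset ℕ) :
    discreteDeriv S (fun A => f (insert i A)) X = discreteDeriv S f (insert i X) := by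
  simp only [discreteDeriv, Finset.insert_union]

lemma discreteDeriv_lin (S : Finset ℕ) (a b : ℝ) (f g : Finset ℕ → ℝ) (X : Finset ℕ) :
    discreteDeriv S (fun A => a * f A + b * g A) X =
      a * discreteDeriv S f X + b * discreteDeriv S g X := by
  simp only [discreteDeriv, Finset.mul_sum, ← Finset.sum_add_distrib]
  exact Finset.sum_congr rfl fun A _ => by ring

lemma biasedExp_lin (p : ℝ) (W : Finset ℕ) (a b : ℝ) (f g : Finset ℕ → ℝ) :
    biasedExp p W (fun A => a * f A + b * g A) = a * biasedExp p W f + b * biasedExp p W g := by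
  rw [biasedExp_add, biasedExp_const_mul, biasedExp_const_mul]

lemma sq_quadratic_le {A B C : ℝ} (hC : C ^ 2 ≤ A * B) (t : ℝ) :
    (A + 2 * t * C + t ^ 2 * B) ^ 2 ≤
      A ^ 2 + 4 * t * (A * C) + 8 * t ^ 2 * (A * B) + 3 * t ^ 4 * B ^ 2 := by
  have h1 : 0 ≤ t ^ 2 * (A * B - C ^ 2) := mul_nonneg (sq_nonneg t) (by linarith)
  nlinarith [mul_nonneg (sq_nonneg t) (sq_nonneg (C - t * B))]

/-- The two-point inequality: `u`, `v` are the values at the two points, `r` is the bias on the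
target side and `δ` the density of the random subset. -/
lemma two_point_inequality {ι : Type*} [Fintype ι] (u v : ι → ℝ) {r δ : ℝ}
    (hr0 : 0 ≤ r) (hr1 : r ≤ 1) (hδ0 : 0 ≤ δ) (hδ1 : δ ≤ 1 / 16) :
    (1 - r) * (∑ j, u j ^ 2) ^ 2 + r * (∑ j, ((1 - δ) * u j + δ * v j) ^ 2) ^ 2 ≤
      (∑ j, ((1 - r * δ) * u j + r * δ * v j) ^ 2 +
        r * δ * (1 - r * δ) / 4 * ∑ j, (v j - u j) ^ 2) ^ 2 +
      3 * δ ^ 4 * r * (∑ j, (v j - u j) ^ 2) ^ 2 := by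
  set a : ι → ℝ := fun j => (1 - r * δ) * u j + r * δ * v j with ha
  set d : ι → ℝ := fun j => v j - u j with hd
  set A := ∑ j, a j ^ 2
  set B := ∑ j, d j ^ 2
  set C := ∑ j, a j * d j
  have hA : 0 ≤ A := Finset.sum_nonneg fun j _ => sq_nonneg _
  have hB : 0 ≤ B := Finset.sum_nonneg fun j _ => sq_nonneg _
  have hC : C ^ 2 ≤ A * B := Finset.sum_mul_sq_le_sq_mul_sq _ _ _
  have expand (t : ℝ) : ∑ j, (a j + t * d j) ^ 2 = A + 2 * t * C + t ^ 2 * B := by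
    simp only [A, B, C, Finset.mul_sum, ← Finset.sum_add_distrib]
    exact Finset.sum_congr rfl fun j _ => by ring
  have hu : ∑ j, u j ^ 2 = A + 2 * (-(r * δ)) * C + (-(r * δ)) ^ 2 * B := by
    rw [← expand]
    exact Finset.sum_congr rfl fun j _ => by simp only [ha, hd]; ring
  have hv : ∑ j, ((1 - δ) * u j + δ * v j) ^ 2 =
      A + 2 * (δ * (1 - r)) * C + (δ * (1 - r)) ^ 2 * B := by
    rw [← expand]
    exact Finset.sum_congr rfl fun j _ => by simp only [ha, hd]; ring
  rw [hu, hv]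
  have h1 := mul_le_mul_of_nonneg_left (sq_quadratic_le hC (-(r * δ)))
    (sub_nonneg.2 hr1)
  have h2 := mul_le_mul_of_nonneg_left (sq_quadratic_le hC (δ * (1 - r))) hr0
  have hAB : 0 ≤ A * B := mul_nonneg hA hB
  have second : 8 * (δ ^ 2 * r * (1 - r)) ≤ r * δ * (1 - r * δ) / 2 := by
    have h3 : 0 ≤ r * δ := mul_nonneg hr0 hδ0
    have h4 : 16 * δ * (1 - r) ≤ 1 - r * δ := by nlinarith
    nlinarith [mul_le_mul_of_nonneg_left h4 h3]
  have fourth : 3 * ((1 - r) * (r * δ) ^ 4 + r * (δ * (1 - r)) ^ 4) ≤ 3 * δ ^ 4 * r := by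
    have h5 : (1 - r) * r ^ 3 + (1 - r) ^ 4 ≤ 1 := by
      have h6 : r ^ 3 ≤ 1 := pow_le_one₀ hr0 hr1
      have h7 : (1 - r) ^ 3 ≤ 1 := pow_le_one₀ (by linarith) (by linarith)
      have h8 : (1 - r) ^ 4 ≤ (1 - r) ^ 1 :=
        pow_le_pow_of_le_one (by linarith) (by linarith) (by norm_num)
      have h9 : r ^ 3 ≤ r ^ 1 := pow_le_pow_of_le_one hr0 hr1 (by norm_num)
      nlinarith
    have h10 : 0 ≤ 3 * δ ^ 4 * r := by positivity
    nlinarith [mul_le_mul_of_nonneg_left h5 h10]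
  have h11 := mul_le_mul_of_nonneg_right second hAB
  have h12 := mul_le_mul_of_nonneg_right fourth (sq_nonneg B)
  have h13 : 0 ≤ (r * δ * (1 - r * δ) / 4 * B) ^ 2 := sq_nonneg _
  nlinarith

/-- Hypercontractivity of the one-sided noise operator, for vector-valued functions all of whose
derivatives have small second moment. -/
theorem biasedExp_fourth_moment_le {r δ G : ℝ} (hr0 : 0 ≤ r) (hr1 : r ≤ 1 / 2) (hδ0 : 0 ≤ δ)
    (hδ1 : δ ≤ 1 / 16) (hδG : δ * G ≤ 1) (W : Finset ℕ) :
    ∀ (ι : Type) [Fintype ι] (f : ι → Finset ℕ → ℝ) (M : ℝ),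
      (∀ S ⊆ W, biasedExp (r * δ) (W \ S) (fun X => ∑ j, discreteDeriv S (f j) X ^ 2) ≤
        G ^ S.card * M) →
      biasedExp r W (fun Y => (∑ j, biasedExp δ Y (f j) ^ 2) ^ 2) ≤
        M * biasedExp (r * δ) W fun X => ∑ j, f j X ^ 2 := by
  have hp0 : 0 ≤ r * δ := mul_nonneg hr0 hδ0
  have hp1 : r * δ ≤ 1 / 32 := by nlinarith
  have hpp : 0 ≤ r * δ * (1 - r * δ) := mul_nonneg hp0 (by linarith)
  have hs := Real.sq_sqrt hpp
  set s := √(r * δ * (1 - r * δ))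
  set p := r * δ with hp
  induction W using Finset.induction_on with
  | empty =>
    intro ι _ f M h
    have h0 := h ∅ (Finset.empty_subset _)
    simp only [biasedExp, discreteDeriv, Finset.powerset_empty, Finset.sum_singleton,
      Finset.card_empty, Finset.sdiff_self, Finset.empty_union] at h0 ⊢
    norm_num at h0 ⊢
    rw [sq]
    exact mul_le_mul_of_nonneg_right h0 (Finset.sum_nonneg fun j _ => sq_nonneg _)
  | insert i W hi ih =>
    intro ι _ f M h
    set a : ι → Finset ℕ → ℝ := fun j A => (1 - p) * f j A + p * f j (insert i A) with ha
    set d : ι → Finset ℕ → ℝ := fun j A => f j (insert i A) - f j A with hd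
    have split_sq (x y : ℝ) :
        ((1 - p) * x + p * y) ^ 2 + p * (1 - p) * (y - x) ^ 2 = (1 - p) * x ^ 2 + p * y ^ 2 := by
      ring
    have deriv_d (S : Finset ℕ) (j : ι) (X : Finset ℕ) : discreteDeriv S (d j) X =
        discreteDeriv S (f j) (insert i X) - discreteDeriv S (f j) X := by
      rw [← discreteDeriv_comp_insert]
      simpa [hd, sub_eq_add_neg] using
        discreteDeriv_lin S 1 (-1) (fun A => f j (insert i A)) (f j) X
    have deriv_a (S : Finset ℕ) (j : ι) (X : Finset ℕ) : discreteDeriv S (a j) X =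
        (1 - p) * discreteDeriv S (f j) X + p * discreteDeriv S (f j) (insert i X) := by
      rw [← discreteDeriv_comp_insert, ← discreteDeriv_lin]
    have first := ih (ι ⊕ ι) (Sum.elim a fun j A => s / 2 * d j A) M fun S hS => by
      refine le_trans ?_ (h S (hS.trans (Finset.subset_insert _ _)))
      have hiS : i ∉ S := fun hh => hi (hS hh)
      rw [Finset.insert_sdiff_of_notMem _ hiS,
        biasedExp_insert p (fun hh => hi (Finset.mem_sdiff.1 hh).1), ← biasedExp_lin]
      refine biasedExp_mono hp0 (by linarith) fun X _ => ?_
      rw [Fintype.sum_sum_type, Finset.mul_sum, Finset.mul_sum, ← Finset.sum_add_distrib,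
        ← Finset.sum_add_distrib]
      refine Finset.sum_le_sum fun j _ => ?_
      have hd' := discreteDeriv_lin S (s / 2) 0 (d j) (d j) X
      simp only [zero_mul, add_zero] at hd'
      simp only [Sum.elim_inl, Sum.elim_inr]
      rw [hd', deriv_a, deriv_d, ← split_sq, mul_pow, div_pow, hs]
      nlinarith [mul_nonneg hpp (sq_nonneg
        (discreteDeriv S (f j) (insert i X) - discreteDeriv S (f j) X))]
    have second := ih ι d (G * M) fun S hS => by
      have hiS : i ∉ S := fun hh => hi (hS hh)
      have h1 := h (insert i S) (Finset.insert_subset_insert i hS)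
      rw [Finset.insert_sdiff_insert, Finset.sdiff_insert_of_notMem hi,
        Finset.card_insert_of_notMem hiS, pow_succ, mul_assoc] at h1
      simpa only [discreteDeriv_insert hiS, neg_sq] using h1
    have hM : 0 ≤ M := by
      refine le_trans ?_ ((h ∅ (Finset.empty_subset _)).trans_eq (by simp))
      exact biasedExp_nonneg hp0 (by linarith) fun X _ =>
        Finset.sum_nonneg fun j _ => sq_nonneg _
    have norm_eq : (biasedExp p W fun X => ∑ j, a j X ^ 2) +
        p * (1 - p) * (biasedExp p W fun X => ∑ j, d j X ^ 2) =
        biasedExp p (insert i W) fun X => ∑ j, f j X ^ 2 := by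
      rw [biasedExp_insert p hi, ← biasedExp_lin, ← biasedExp_const_mul, ← biasedExp_add]
      refine biasedExp_congr p fun X _ => ?_
      simp only [Finset.mul_sum, ← Finset.sum_add_distrib]
      exact Finset.sum_congr rfl fun j _ => split_sq _ _
    have norm_first : (biasedExp p W fun X =>
        ∑ j, (Sum.elim a (fun j A => s / 2 * d j A) : ι ⊕ ι → Finset ℕ → ℝ) j X ^ 2) =
        (biasedExp p W fun X => ∑ j, a j X ^ 2) +
          p * (1 - p) / 4 * biasedExp p W fun X => ∑ j, d j X ^ 2 := by
      rw [← biasedExp_const_mul, ← biasedExp_add]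
      refine biasedExp_congr p fun X _ => ?_
      simp only [Fintype.sum_sum_type, Sum.elim_inl, Sum.elim_inr, mul_pow, div_pow, hs,
        Finset.mul_sum]
      norm_num
    have step : (biasedExp r (insert i W) fun Y => (∑ j, biasedExp δ Y (f j) ^ 2) ^ 2) ≤
        (biasedExp r W fun Y => (∑ j, biasedExp δ Y
          ((Sum.elim a fun j A => s / 2 * d j A : ι ⊕ ι → Finset ℕ → ℝ) j) ^ 2) ^ 2) +
        3 * δ ^ 4 * r * biasedExp r W fun Y => (∑ j, biasedExp δ Y (d j) ^ 2) ^ 2 := by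
      rw [biasedExp_insert r hi, ← biasedExp_lin, ← biasedExp_const_mul, ← biasedExp_add]
      refine biasedExp_mono hr0 (by linarith) fun Y hY => ?_
      have hiY : i ∉ Y := fun hh => hi (hY hh)
      have key := two_point_inequality (fun j => biasedExp δ Y (f j))
        (fun j => biasedExp δ Y fun A => f j (insert i A)) hr0 (by linarith) hδ0 hδ1
      have exp_a (j : ι) : biasedExp δ Y (a j) = (1 - r * δ) * biasedExp δ Y (f j) +
          r * δ * biasedExp δ Y fun A => f j (insert i A) := biasedExp_lin _ _ _ _ _ _
      have exp_d (j : ι) : biasedExp δ Y (d j) =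
          (biasedExp δ Y fun A => f j (insert i A)) - biasedExp δ Y (f j) := by
        simpa [hd, sub_eq_add_neg] using
          biasedExp_lin δ Y 1 (-1) (fun A => f j (insert i A)) (f j)
      simp only [Fintype.sum_sum_type, Sum.elim_inl, Sum.elim_inr, biasedExp_insert δ hiY,
        biasedExp_const_mul, mul_pow, div_pow, hs, ← Finset.mul_sum, exp_a, exp_d]
      norm_num at key ⊢
      exact key
    rw [norm_first] at first
    set Na := biasedExp p W fun X => ∑ j, a j X ^ 2
    set Nd := biasedExp p W fun X => ∑ j, d j X ^ 2
    have hNd : 0 ≤ Nd := biasedExp_nonneg hp0 (by linarith) fun X _ =>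
      Finset.sum_nonneg fun j _ => sq_nonneg _
    rw [← norm_eq]
    have coef : 3 * δ ^ 4 * r * G ≤ 3 / 4 * (p * (1 - p)) := by
      have h1 : 3 * δ ^ 4 * r * G = p * (3 * δ ^ 2 * (δ * G)) := by rw [hp]; ring
      have h2 : 3 * δ ^ 2 * (δ * G) ≤ 3 / 4 * (1 - p) := by
        have h3 : 3 * δ ^ 2 * (δ * G) ≤ 3 * δ ^ 2 * 1 :=
          mul_le_mul_of_nonneg_left hδG (by positivity)
        nlinarith
      rw [h1]
      nlinarith [mul_le_mul_of_nonneg_left h2 hp0]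
    have h4 := mul_le_mul_of_nonneg_left second (show 0 ≤ 3 * δ ^ 4 * r by positivity)
    have h5 := mul_le_mul_of_nonneg_right coef (mul_nonneg hM hNd)
    nlinarith

lemma muB_eq_biasedExp (p : ℝ) {W : Finset ℕ} {F : Finset (Finset ℕ)} (hF : F ⊆ W.powerset) :
    muB W.card p F = biasedExp p W fun A => if A ∈ F then 1 else 0 := by
  simp only [muB, biasedExp, mul_ite, mul_one, mul_zero]
  rw [← Finset.sum_filter, Finset.filter_mem_eq_inter, Finset.inter_eq_right.2 hF]

lemma biasedExp_union_eq_muB (p : ℝ) {W A B : Finset ℕ} {F : Finset (Finset ℕ)}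
    (hF : F ⊆ W.powerset) (hAB : A ⊆ B) (hB : B ⊆ W) :
    (biasedExp p (W \ B) fun X => if X ∪ A ∈ F then 1 else 0) =
      muB (W.card - B.card) p (famRestrict2 F A B) := by
  rw [← Finset.card_sdiff_of_subset hB, muB_eq_biasedExp]
  · refine biasedExp_congr p fun X hX => ?_
    have hXB : Disjoint X B := Finset.disjoint_of_subset_left hX Finset.sdiff_disjoint
    congr 1
    simp only [famRestrict2, Finset.mem_image, Finset.mem_filter, eq_iff_iff]
    constructor
    · intro h
      refine ⟨X ∪ A, ⟨h, ?_⟩, ?_⟩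
      · rw [Finset.union_inter_distrib_right, Finset.disjoint_iff_inter_eq_empty.1 hXB,
          Finset.empty_union, Finset.inter_eq_left.2 hAB]
      · rw [Finset.union_sdiff_distrib, Finset.sdiff_eq_empty_iff_subset.2 hAB,
          Finset.union_empty, Finset.sdiff_eq_self_of_disjoint hXB]
    · rintro ⟨Y, ⟨hY, rfl⟩, rfl⟩
      rwa [Finset.sdiff_union_inter]
  · intro X hX
    simp only [famRestrict2, Finset.mem_image, Finset.mem_filter] at hX
    obtain ⟨Y, ⟨hY, -⟩, rfl⟩ := hX
    exact Finset.mem_powerset.2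
      (Finset.sdiff_subset_sdiff (Finset.mem_powerset.1 (hF hY)) le_rfl)

/-- Derivatives of the indicator of a global family have small second moment. -/
lemma IsGlobalOn.biasedExp_discreteDeriv_sq_le {W : Finset ℕ} {p τ : ℝ}
    {F : Finset (Finset ℕ)} (h : IsGlobalOn W p τ F) (hF : F ⊆ W.powerset) (h0 : 0 ≤ p)
    (h1 : p ≤ 1) {S : Finset ℕ} (hS : S ⊆ W) :
    (biasedExp p (W \ S) fun X =>
      discreteDeriv S (fun A => if A ∈ F then 1 else 0) X ^ 2) ≤
        (4 * τ) ^ S.card * muB W.card p F := by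
  calc _ ≤ biasedExp p (W \ S) fun X =>
        2 ^ S.card * ∑ A ∈ S.powerset, if X ∪ A ∈ F then (1 : ℝ) else 0 := by
        refine biasedExp_mono h0 h1 fun X _ => ?_
        refine (sq_sum_le_card_mul_sum_sq (s := S.powerset)).trans_eq ?_
        rw [Finset.card_powerset]
        push_cast
        congr 1
        refine Finset.sum_congr rfl fun A _ => ?_
        rw [mul_pow, ← pow_mul, mul_comm A.card, pow_mul]
        split_ifs <;> norm_num
    _ = 2 ^ S.card * ∑ A ∈ S.powerset, muB (W.card - S.card) p (famRestrict2 F A S) := by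
        rw [biasedExp_const_mul, biasedExp_sum]
        congr 1
        exact Finset.sum_congr rfl fun A hA =>
          biasedExp_union_eq_muB p hF (Finset.mem_powerset.1 hA) hS
    _ ≤ 2 ^ S.card * ∑ A ∈ S.powerset, τ ^ S.card * muB W.card p F := by
        gcongr with A hA
        exact h A S (Finset.mem_powerset.1 hA) hS
    _ = (4 * τ) ^ S.card * muB W.card p F := by
        rw [Finset.sum_const, Finset.card_powerset, nsmul_eq_mul, mul_pow,
          show (4 : ℝ) = 2 * 2 by norm_num, mul_pow]
        push_cast
        ring

/-- Hölder's inequality against an indicator, with exponents `4/3` and `4`. -/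
lemma biasedExp_ite_mul_pow_four_le {p : ℝ} (h0 : 0 ≤ p) (h1 : p ≤ 1) (W : Finset ℕ)
    (P : Finset ℕ → Prop) [DecidablePred P] (g : Finset ℕ → ℝ) :
    (biasedExp p W fun A => (if P A then 1 else 0) * g A) ^ 4 ≤
      (biasedExp p W fun A => if P A then 1 else 0) ^ 3 * biasedExp p W fun A => g A ^ 4 := by
  have h2 : 0 ≤ 1 - p := by linarith
  have cauchy (f : Finset ℕ → ℝ) : (biasedExp p W fun A => (if P A then 1 else 0) * f A) ^ 2 ≤
      (biasedExp p W fun A => if P A then 1 else 0) *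
        biasedExp p W fun A => (if P A then 1 else 0) * f A ^ 2 := by
    refine Finset.sum_sq_le_sum_mul_sum_of_sq_le_mul _ (fun A _ => ?_) (fun A _ => ?_)
      (fun A _ => ?_)
    · positivity
    · positivity
    · exact le_of_eq (by beta_reduce; split_ifs <;> ring)
  set μ := biasedExp p W fun A => if P A then (1 : ℝ) else 0
  have hμ : 0 ≤ μ := biasedExp_nonneg h0 h1 fun A _ => by positivity
  have h4 : (biasedExp p W fun A => (if P A then 1 else 0) * (g A ^ 2) ^ 2) ≤
      biasedExp p W fun A => g A ^ 4 := by
    refine biasedExp_mono h0 h1 fun A _ => ?_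
    rw [← pow_mul]
    split_ifs
    · simp
    · simpa using (by positivity : 0 ≤ g A ^ 4)
  calc _ = ((biasedExp p W fun A => (if P A then 1 else 0) * g A) ^ 2) ^ 2 := by ring
    _ ≤ (μ * biasedExp p W fun A => (if P A then 1 else 0) * g A ^ 2) ^ 2 :=
        pow_le_pow_left₀ (sq_nonneg _) (cauchy g) 2
    _ = μ ^ 2 * (biasedExp p W fun A => (if P A then 1 else 0) * g A ^ 2) ^ 2 := mul_pow _ _ 2
    _ ≤ μ ^ 2 * (μ * biasedExp p W fun A => g A ^ 4) := by
        refine mul_le_mul_of_nonneg_left ((cauchy fun A => g A ^ 2).trans ?_) (sq_nonneg _)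
        exact mul_le_mul_of_nonneg_left h4 hμ
    _ = _ := by ring

/-- Lemma 5.15 (one-step sharp threshold for global families). -/
theorem one_step_sharp_threshold (n : ℕ) (τ p : ℝ) (hτ : 1 ≤ τ)
    (hp : p ∈ Set.Ioo (0:ℝ) ((2:ℝ)^(-7:ℤ) / τ))
    (F : Finset (Finset ℕ)) (hF : F ⊆ (Finset.range n).powerset)
    (hup : ∀ A ∈ F, ∀ B ⊆ Finset.range n, A ⊆ B → B ∈ F)
    (hglob : IsGlobalOn (Finset.range n) p τ F) :
    (muB n p F) ^ ((3:ℝ)/4) ≤ muB n ((2:ℝ)^6 * τ * p) F := by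
  have hτ0 : 0 < τ := by linarith
  obtain ⟨hp0, hp1⟩ := hp
  have hτp : τ * p < 1 / 128 := by
    rw [lt_div_iff₀ hτ0] at hp1
    norm_num at hp1
    linarith
  set W := Finset.range n
  have hW : W.card = n := Finset.card_range n
  set r := (2 : ℝ) ^ 6 * τ * p with hr
  set δ := 1 / (64 * τ) with hδ
  have hr0 : 0 ≤ r := by positivity
  have hr1 : r ≤ 1 / 2 := by rw [hr]; linarith
  have hδ0 : 0 ≤ δ := by positivity
  have hδ1 : δ ≤ 1 / 16 := by
    rw [hδ, div_le_div_iff₀ (by positivity) (by norm_num)]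
    linarith
  have hrδ : r * δ = p := by rw [hr, hδ]; field_simp; norm_num
  have hδG : δ * (4 * τ) ≤ 1 := by
    rw [hδ, div_mul_eq_mul_div, div_le_one (by positivity)]
    linarith
  have hp1' : p ≤ 1 := by nlinarith
  have hμ := muB_eq_biasedExp p hF
  have hμr := muB_eq_biasedExp r hF
  rw [← hW]
  set f : Finset ℕ → ℝ := fun A => if A ∈ F then 1 else 0 with hf
  have hyper := biasedExp_fourth_moment_le hr0 hr1 hδ0 hδ1 hδG W
    Unit (fun _ => f) (muB W.card p F) fun S hS => by
      rw [hrδ]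
      simpa using hglob.biasedExp_discreteDeriv_sq_le hF hp0.le hp1' hS
  have f_sq (X : Finset ℕ) : f X ^ 2 = f X := by simp only [hf]; split_ifs <;> norm_num
  simp only [Finset.univ_unique, Finset.sum_const, Finset.card_singleton, one_smul, f_sq,
    ← pow_mul, hrδ] at hyper
  rw [← hμ] at hyper
  have noise : muB W.card p F = biasedExp r W fun Y => f Y * biasedExp δ Y f := by
    rw [hμ, ← hrδ, ← biasedExp_biasedExp]
    refine biasedExp_congr r fun Y hY => ?_
    by_cases hYF : Y ∈ F
    · simp [hf, hYF]
    · have hzero : biasedExp δ Y f = biasedExp δ Y fun _ => 0 :=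
        biasedExp_congr δ fun A hA => if_neg fun hAF => hYF (hup A hAF Y hY hA)
      rw [hzero, biasedExp_const, mul_zero]
  have holder : muB W.card p F ^ 4 ≤
      muB W.card r F ^ 3 * biasedExp r W fun Y => biasedExp δ Y f ^ 4 := by
    rw [noise, hμr]
    exact biasedExp_ite_mul_pow_four_le hr0 (by linarith) W (· ∈ F) fun Y => biasedExp δ Y f
  have hf0 (A : Finset ℕ) : 0 ≤ f A := by simp only [hf]; positivity
  have hx0 : 0 ≤ muB W.card p F := hμ ▸ biasedExp_nonneg hp0.le hp1' fun A _ => hf0 A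
  have hx1 : muB W.card p F ≤ 1 := by
    rw [hμ, ← biasedExp_const p W 1]
    exact biasedExp_mono hp0.le hp1' fun A _ => by simp only [hf]; split_ifs <;> norm_num
  have hy0 : 0 ≤ muB W.card r F := hμr ▸ biasedExp_nonneg hr0 (by linarith) fun A _ => hf0 A
  set x := muB W.card p F
  set y := muB W.card r F
  rcases hx0.eq_or_lt with hx | hx
  · rw [← hx, Real.zero_rpow (by norm_num)]
    exact hy0
  have hxy : x ^ 2 ≤ y ^ 3 := by
    have h1 : x ^ 2 * x ^ 2 ≤ y ^ 3 * x ^ 2 :=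
      calc x ^ 2 * x ^ 2 = x ^ 4 := by ring
        _ ≤ _ := holder
        _ ≤ y ^ 3 * (x * x) := mul_le_mul_of_nonneg_left hyper (by positivity)
        _ = _ := by ring
    exact le_of_mul_le_mul_right h1 (by positivity)
  refine le_of_pow_le_pow_left₀ (n := 3) (by norm_num) hy0 (le_trans ?_ hxy)
  rw [← Real.rpow_mul_natCast hx.le, ← Real.rpow_natCast x 2]
  exact Real.rpow_le_rpow_of_exponent_ge hx hx1 (by norm_num)
end
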